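/- arXiv:2312.03994 — 3 statements merged into one kernel-verified Lean document; each statement's English description precedes it below -/
import Mathlib

section
/- Let D = D1• # D2• be a connected sum of based Gauss diagrams. If a decreasing FR2 move can be applied to D using one arrow coming from D1 and one arrow coming from D2, then D1 admits a decreasing FR1 move and D2 admits a decreasing FR1 move; in particular, if D1 and D2 each contain at least one arrow and are minimal crossing diagrams, then no decreasing FR2 move on D can involve one arrow from each summand. -/
/-!
Combinatorial model of flat virtual knots via Gauss diagrams.

A Gauss diagram with `n` arrows is a counterclockwise-oriented circle with `2n`
marked points partitioned into `n` ordered pairs (arrows).  We encode it as a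
cyclic double-occurrence word: a list of endpoints read counterclockwise from an
arbitrarily chosen starting point (a basepoint), where an endpoint is a pair
`(a, s)` consisting of the label `a : ℕ` of its arrow and a Boolean `s`
recording whether it is the head (`true`) or tail (`false`) of the arrow.
Rotating the list corresponds to moving the basepoint around the circle.
-/

/-- An endpoint of an arrow: `(arrow label, isHead)`. -/
abbrev Endpoint := ℕ × Bool

/-- A (based) Gauss diagram: the cyclic word read counterclockwise from the
basepoint.  The underlying (cyclic) Gauss diagram is the list up to rotation
and relabelling of the arrows. -/
abbrev GDiagram := List Endpoint

/-- The double-occurrence condition: every arrow label that occurs, occurs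
exactly once as a head and exactly once as a tail. -/
def IsGauss (D : GDiagram) : Prop :=
  ∀ a : ℕ,
    (List.count (a, true) D = 0 ∧ List.count (a, false) D = 0) ∨
    (List.count (a, true) D = 1 ∧ List.count (a, false) D = 1)

/-- The crossing number of a Gauss diagram: its number of arrows. -/
def cr (D : GDiagram) : ℕ := D.length / 2

/-- Relabel the arrows of a diagram by `f`. -/
def relabel (f : ℕ → ℕ) (D : GDiagram) : GDiagram := D.map fun e => (f e.1, e.2)

/-- `Rot D D'` : `D'` is a cyclic rotation of `D`, i.e. the same cyclic Gauss
diagram with another choice of basepoint. -/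
def Rot (D D' : GDiagram) : Prop := ∃ u v : GDiagram, D = u ++ v ∧ D' = v ++ u

/-- `Same D D'` : `D` and `D'` present the same abstract cyclic Gauss diagram,
i.e. they agree up to rotation (choice of basepoint) and injective relabelling
of the arrows. -/
def Same (D D' : GDiagram) : Prop :=
  ∃ (f : ℕ → ℕ) (u v : GDiagram),
    Function.Injective f ∧ D = u ++ v ∧ D' = relabel f (v ++ u)

/-- Raw decreasing FR1 move on the word: delete one arrow whose two endpoints
are adjacent on the circle (both directions of the kink). -/
def fr1 (D D' : GDiagram) : Prop :=
  ∃ (a : ℕ) (s : Bool) (u v : GDiagram),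
    D = u ++ [(a, s), (a, !s)] ++ v ∧ D' = u ++ v

/-- Raw decreasing FR2 move deleting the two arrows labelled `a` and `b`:
the two heads occupy adjacent positions and the two tails occupy adjacent
positions (the four oriented variants correspond to the orders of the heads
and of the tails). -/
def fr2with (a b : ℕ) (D D' : GDiagram) : Prop :=
  ∃ (x y z t : ℕ) (u v w : GDiagram),
    a ≠ b ∧ ({x, y} : Set ℕ) = {a, b} ∧ ({z, t} : Set ℕ) = {a, b} ∧
    D = u ++ [(x, true), (y, true)] ++ v ++ [(z, false), (t, false)] ++ w ∧
    D' = u ++ v ++ w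

/-- Raw decreasing FR2 move. -/
def fr2 (D D' : GDiagram) : Prop := ∃ a b : ℕ, fr2with a b D D'

/-- Raw FR3 (triangle) move on the three arrows labelled `a`, `b`, `c`:
the six endpoints of the three arrows form three pairwise-adjacent endpoint
pairs (each pair containing endpoints of two different arrows), and the move
simultaneously slides (swaps) the three adjacent pairs.  The number of arrows
is preserved. -/
def fr3with (a b c : ℕ) (D D' : GDiagram) : Prop :=
  ∃ (e1 e2 e3 e4 e5 e6 : Endpoint) (u v w x : GDiagram),
    a ≠ b ∧ b ≠ c ∧ a ≠ c ∧
    e1.1 ≠ e2.1 ∧ e3.1 ≠ e4.1 ∧ e5.1 ≠ e6.1 ∧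
    ({e1, e2, e3, e4, e5, e6} : Multiset Endpoint) =
      {(a, true), (a, false), (b, true), (b, false), (c, true), (c, false)} ∧
    D = u ++ [e1, e2] ++ v ++ [e3, e4] ++ w ++ [e5, e6] ++ x ∧
    D' = u ++ [e2, e1] ++ v ++ [e4, e3] ++ w ++ [e6, e5] ++ x

/-- Raw FR3 move. -/
def fr3 (D D' : GDiagram) : Prop := ∃ a b c : ℕ, fr3with a b c D D'

/-- A raw move pattern performed anywhere on the cyclic diagram: apply the raw
(linear-word) move `r` after presenting the diagrams by suitable choices of
basepoint and labels. -/
def stepOf (r : GDiagram → GDiagram → Prop) (D D' : GDiagram) : Prop :=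
  ∃ E E' : GDiagram, Same D E ∧ r E E' ∧ Same E' D'

/-- Decreasing FR1 move (deletes one arrow). -/
def FR1Del : GDiagram → GDiagram → Prop := stepOf fr1
/-- Increasing FR1 move (inserts one arrow). -/
def FR1Ins : GDiagram → GDiagram → Prop := stepOf fun X Y => fr1 Y X
/-- Decreasing FR2 move (deletes two arrows). -/
def FR2Del : GDiagram → GDiagram → Prop := stepOf fr2
/-- Increasing FR2 move (inserts two arrows). -/
def FR2Ins : GDiagram → GDiagram → Prop := stepOf fun X Y => fr2 Y X
/-- FR3 move (preserves the number of arrows). -/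
def FR3Move : GDiagram → GDiagram → Prop := stepOf fr3

/-- One flat Reidemeister move between Gauss diagrams (or a re-presentation of
the same cyclic diagram). -/
def Move (D D' : GDiagram) : Prop :=
  IsGauss D ∧ IsGauss D' ∧
    (FR1Del D D' ∨ FR1Ins D D' ∨ FR2Del D D' ∨ FR2Ins D D' ∨
      FR3Move D D' ∨ Same D D')

/-- Flat equivalence of Gauss diagrams: the equivalence relation generated by
the flat Reidemeister moves.  A flat virtual knot is a `FlatEq`-class. -/
def FlatEq : GDiagram → GDiagram → Prop := Relation.EqvGen Move

/-- The crossing number of the flat virtual knot represented by `D`: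
the minimum of `cr E` over all Gauss diagrams `E` flat equivalent to `D`. -/
noncomputable def crKnot (D : GDiagram) : ℕ :=
  sInf {n : ℕ | ∃ E : GDiagram, IsGauss E ∧ FlatEq D E ∧ cr E = n}

/-- `D1` and `D2` use disjoint sets of arrow labels (so that no arrow of
`D1 ++ D2` joins the two arcs). -/
def LabelDisjoint (D1 D2 : GDiagram) : Prop :=
  ∀ (a : ℕ) (s s' : Bool), (a, s) ∈ D1 → (a, s') ∉ D2

/-- Pure relabelling of a (long) Gauss diagram. -/
def Relabel (D D' : GDiagram) : Prop :=
  ∃ f : ℕ → ℕ, Function.Injective f ∧ D' = relabel f D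

/-- One flat Reidemeister move between long Gauss diagrams: the raw moves
performed inside the interval (no rotation is allowed, since a long diagram is
linearly ordered), together with relabelling. -/
def LongMove (D D' : GDiagram) : Prop :=
  IsGauss D ∧ IsGauss D' ∧
    (fr1 D D' ∨ fr1 D' D ∨ fr2 D D' ∨ fr2 D' D ∨ fr3 D D' ∨ Relabel D D')

/-- Long flat equivalence of long Gauss diagrams.  A long flat virtual knot is
a `LongEq`-class. -/
def LongEq : GDiagram → GDiagram → Prop := Relation.EqvGen LongMove

/-- A long Gauss diagram is trivial as a long flat virtual knot if it is
long flat equivalent to the empty long diagram. -/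
def LongTrivial (D : GDiagram) : Prop := LongEq D []

/-- `D` admits a decreasing FR1 move (performed anywhere on the cyclic
diagram, i.e. on some rotation of `D`). -/
def HasDecFR1 (D : GDiagram) : Prop := ∃ E E' : GDiagram, Rot D E ∧ fr1 E E'

theorem aux_infix {e f : Endpoint} {A B p q : GDiagram} (h : A ++ B = p ++ e :: f :: q) :
    (e ∈ A ∧ f ∈ A) ∨ (e ∈ B ∧ f ∈ B) ∨ (A.getLast? = some e ∧ B.head? = some f) := by
  rcases List.append_eq_append_iff.1 h with ⟨c, rfl, rfl⟩ | ⟨c, rfl, hc⟩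
  · right; left; simp
  · match c, hc with
    | [], hc => right; left; simp at hc; subst hc; simp
    | [x], hc =>
      simp at hc; obtain ⟨rfl, rfl⟩ := hc
      right; right; simp
    | x :: y :: c, hc =>
      simp at hc; obtain ⟨rfl, rfl, rfl⟩ := hc
      left; simp

/-- the version of `aux_infix` that remembers the factor as a sublist of `A` or `B` -/
theorem aux_infix2 {e f : Endpoint} {A B p q : GDiagram} (h : A ++ B = p ++ e :: f :: q) :
    (∃ p' q', A = p' ++ e :: f :: q') ∨ (∃ p' q', B = p' ++ e :: f :: q') ∨
      (e ∈ A ∧ B.head? = some f) := by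
  rcases List.append_eq_append_iff.1 h with ⟨c, rfl, rfl⟩ | ⟨c, rfl, hc⟩
  · right; left; exact ⟨_, _, rfl⟩
  · match c, hc with
    | [], hc => right; left; simp at hc; subst hc; exact ⟨[], q, rfl⟩
    | [x], hc =>
      simp at hc; obtain ⟨rfl, rfl⟩ := hc
      right; right; simp
    | x :: y :: c, hc =>
      simp at hc; obtain ⟨rfl, rfl, rfl⟩ := hc
      left; exact ⟨p, c, rfl⟩

theorem aux_rot {e f : Endpoint} {D1 D2 p q : GDiagram}
    (h : (D1 ++ D2).IsRotated (p ++ e :: f :: q)) (he : e ∉ D2) (hf : f ∉ D1) :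
    D1.getLast? = some e ∧ D2.head? = some f := by
  have key : ∀ p' q' : GDiagram, D1 ++ D2 = p' ++ e :: f :: q' →
      D1.getLast? = some e ∧ D2.head? = some f := by
    intro p' q' h'
    rcases aux_infix h' with h | h | h
    · exact absurd h.2 hf
    · exact absurd h.1 he
    · exact h
  have hmem : e ∈ D1 := by
    have : e ∈ D1 ++ D2 := h.mem_iff.2 (by simp)
    rcases List.mem_append.1 this with h | h
    · exact h
    · exact absurd h he
  obtain ⟨n, hn⟩ := h
  rw [List.rotate_eq_drop_append_take_mod] at hn
  have hUV := List.take_append_drop (n % (D1 ++ D2).length) (D1 ++ D2)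
  generalize List.take (n % (D1 ++ D2).length) (D1 ++ D2) = U at hn hUV
  generalize List.drop (n % (D1 ++ D2).length) (D1 ++ D2) = V at hn hUV
  rcases aux_infix2 hn with ⟨p', q', rfl⟩ | ⟨p', q', rfl⟩ | ⟨_, h3⟩
  · exact key (U ++ p') q' (by rw [← hUV]; simp)
  · exact key p' (q' ++ V) (by rw [← hUV]; simp)
  · exfalso
    cases U with
    | nil => simp at h3
    | cons x U =>
      simp at h3; subst h3
      cases D1 with
      | nil => simp at hmem
      | cons y D1 =>
        simp at hUV
        exact hf (by simp [hUV.1])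

theorem aux_fr1 {c : ℕ} {s : Bool} {D : GDiagram} (hh : D.head? = some (c, s))
    (hl : D.getLast? = some (c, !s)) : HasDecFR1 D := by
  cases D with
  | nil => simp at hh
  | cons x D =>
    simp at hh; subst hh
    rcases List.eq_nil_or_concat D with rfl | ⟨m, y, rfl⟩
    · simp at hl
    · have : y = (c, !s) := by
        rw [List.concat_eq_append, ← List.cons_append, List.getLast?_concat] at hl
        simpa using hl
      subst this
      exact ⟨[(c, !s)] ++ (c, s) :: m, m, ⟨(c, s) :: m, [(c, !s)], by simp, rfl⟩,
        c, !s, [], m, by simp, rfl⟩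

theorem aux_rotated {D E : GDiagram} (h : Rot D E) : D.IsRotated E := by
  obtain ⟨u, v, rfl, rfl⟩ := h
  exact List.isRotated_append

theorem aux_main {D1 D2 : GDiagram} (hdisj : LabelDisjoint D1 D2)
    (h : ∃ (a b : ℕ) (E E' : GDiagram), Rot (D1 ++ D2) E ∧ fr2with a b E E' ∧
        (∃ s, (a, s) ∈ D1) ∧ (∃ s, (b, s) ∈ D2)) : HasDecFR1 D1 ∧ HasDecFR1 D2 := by
  obtain ⟨a, b, E, E', hR, ⟨x, y, z, t, u, v, w, hab, hxy, hzt, hE, -⟩, ⟨s, ha⟩, ⟨s', hb⟩⟩ := h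
  have ha2 : ∀ r, (a, r) ∉ D2 := fun r => hdisj a s r ha
  have hb1 : ∀ r, (b, r) ∉ D1 := fun r hr => hdisj b r s' hr hb
  have hr1 := aux_rotated hR
  have hr2 : (D2 ++ D1).IsRotated E := List.isRotated_append.trans hr1
  have e1 : E = u ++ (x, true) :: (y, true) :: (v ++ [(z, false), (t, false)] ++ w) := by
    rw [hE]; simp
  have e2 : E = (u ++ [(x, true), (y, true)] ++ v) ++ (z, false) :: (t, false) :: w := by
    rw [hE]; simp
  have f1 := e1 ▸ hr1
  have f2 := e2 ▸ hr1
  have g1 := e1 ▸ hr2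
  have g2 := e2 ▸ hr2
  rcases Set.pair_eq_pair_iff.1 hxy with ⟨rfl, rfl⟩ | ⟨rfl, rfl⟩ <;>
  rcases Set.pair_eq_pair_iff.1 hzt with ⟨rfl, rfl⟩ | ⟨rfl, rfl⟩
  · have p1 := aux_rot f1 (ha2 _) (hb1 _)
    have p2 := aux_rot f2 (ha2 _) (hb1 _)
    rw [p1.1] at p2; simp at p2
  · have p1 := aux_rot f1 (ha2 _) (hb1 _)
    have p2 := aux_rot g2 (hb1 _) (ha2 _)
    exact ⟨aux_fr1 p2.2 p1.1, aux_fr1 p1.2 p2.1⟩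
  · have p1 := aux_rot g1 (hb1 _) (ha2 _)
    have p2 := aux_rot f2 (ha2 _) (hb1 _)
    exact ⟨aux_fr1 p1.2 p2.1, aux_fr1 p2.2 p1.1⟩
  · have p1 := aux_rot g1 (hb1 _) (ha2 _)
    have p2 := aux_rot g2 (hb1 _) (ha2 _)
    rw [p1.1] at p2; simp at p2

theorem aux_same {D E : GDiagram} (h : Rot D E) : Same D E := by
  obtain ⟨u, v, rfl, rfl⟩ := h
  exact ⟨id, u, v, Function.injective_id, rfl, by simp [relabel]⟩

theorem aux_min {D : GDiagram} (hD : IsGauss D) (h : HasDecFR1 D) (hm : cr D = crKnot D) :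
    False := by
  obtain ⟨E, E', hR, c, s, u, v, hE, hE'⟩ := h
  have hperm := (aux_rotated hR).perm
  have hcount : ∀ e : Endpoint, List.count e D =
      List.count e E' + List.count e [(c, s), (c, !s)] := by
    intro e
    rw [hperm.count_eq, hE, hE']; simp only [List.count_append]; omega
  have hG : IsGauss E' := by
    intro a
    have h := hD a
    have k1 := hcount (a, true)
    have k2 := hcount (a, false)
    by_cases hac : a = c
    · subst hac
      have q1 : List.count (a, true) [(a, s), (a, !s)] = 1 := by cases s <;> simp
      have q2 : List.count (a, false) [(a, s), (a, !s)] = 1 := by cases s <;> simp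
      omega
    · have q1 : List.count (a, true) [(c, s), (c, !s)] = 0 := by
        simp [List.count_eq_zero, hac]
      have q2 : List.count (a, false) [(c, s), (c, !s)] = 0 := by
        simp [List.count_eq_zero, hac]
      omega
  have hmove : Move D E' :=
    ⟨hD, hG, Or.inl ⟨E, E', aux_same hR, ⟨c, s, u, v, hE, hE'⟩,
      aux_same ⟨[], E', by simp, by simp⟩⟩⟩
  have hle : crKnot D ≤ cr E' := Nat.sInf_le ⟨E', hG, Relation.EqvGen.rel _ _ hmove, rfl⟩
  have hlen : D.length = E'.length + 2 := by
    rw [hperm.length_eq, hE, hE']; simp; omega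
  rw [← hm] at hle
  simp only [cr, hlen] at hle
  omega

/-- Let `D = D1 ++ D2` be a connected sum.  If a decreasing
FR2 move can be applied to `D` using one arrow coming from `D1` and one
arrow coming from `D2`, then `D1` admits a decreasing FR1 move and `D2`
admits a decreasing FR1 move.  In particular, if `D1` and `D2` each contain
at least one arrow and are minimal crossing diagrams, then no decreasing FR2
move on `D` involves one arrow from each summand. -/
theorem split_FR2_gives_FR1
    (D1 D2 : GDiagram) (h1 : IsGauss D1) (h2 : IsGauss D2)
    (hdisj : LabelDisjoint D1 D2) :
    ((∃ (a b : ℕ) (E E' : GDiagram), Rot (D1 ++ D2) E ∧ fr2with a b E E' ∧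
        (∃ s, (a, s) ∈ D1) ∧ (∃ s, (b, s) ∈ D2)) →
      HasDecFR1 D1 ∧ HasDecFR1 D2) ∧
    (D1 ≠ [] → D2 ≠ [] → cr D1 = crKnot D1 → cr D2 = crKnot D2 →
      ¬ ∃ (a b : ℕ) (E E' : GDiagram), Rot (D1 ++ D2) E ∧ fr2with a b E E' ∧
          (((∃ s, (a, s) ∈ D1) ∧ (∃ s, (b, s) ∈ D2)) ∨
           ((∃ s, (a, s) ∈ D2) ∧ (∃ s, (b, s) ∈ D1)))) := by
  refine ⟨aux_main hdisj, ?_⟩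
  rintro - - hm1 - ⟨a, b, E, E', hR, hf, hc⟩
  refine aux_min h1 (aux_main hdisj ?_).1 hm1
  rcases hc with ⟨ha, hb⟩ | ⟨ha, hb⟩
  · exact ⟨a, b, E, E', hR, hf, ha, hb⟩
  · obtain ⟨x, y, z, t, u, v, w, hab, hxy, hzt, hE⟩ := hf
    exact ⟨b, a, E, E', hR, ⟨x, y, z, t, u, v, w, hab.symm,
      hxy.trans (Set.pair_comm a b), hzt.trans (Set.pair_comm a b), hE⟩, hb, ha⟩
end

section
/- There exist Gauss diagrams D1 and D2, each representing the trivial flat virtual knot (the flat-equivalence class of the empty Gauss diagram), and choices of basepoints, such that the connected sum D1• # D2• represents a nontrivial flat virtual knot; consequently the super-additivity inequality cr(α) ≥ cr(α1) + cr(α2) for connected sums of flat virtual knots can be strict. -/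
namespace FlatInv

open Finset

/-- Axioms of the local weight used in the state sum. -/
structure Good {X : Type} [Fintype X] [DecidableEq X] (R : X → X → X → X → ZMod 2)
    (st : X → X) (par : X → Bool) : Prop where
  st_st : ∀ x, st (st x) = x
  par_st : ∀ x, par (st x) = !par x
  card : ∀ p : Bool, ((univ.filter fun x => par x = p).card : ZMod 2) = 0
  sym : ∀ x x' y y', R x x' y y' = R y y' x x'
  rev : ∀ x x' y y', R x x' y y' = R (st x') (st x) y y'
  hpar : ∀ x x' y y', R x x' y y' ≠ 0 → par x' = !par x
  even : ∀ x x' y y', par x ≠ par y → R x x' y y' =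
    if par x' = !par x then
      ((if x' = y ∧ y' = x then 1 else 0) + (if y = st x ∧ y' = st x' then 1 else 0)) else 0
  two : ∀ x x' y y', ∑ m, ∑ n, R x m y n * R m x' n y' = if x = x' ∧ y = y' then 1 else 0

section
variable {X : Type} [Fintype X] [DecidableEq X] {R : X → X → X → X → ZMod 2}
    {st : X → X} {par : X → Bool}

def stEquiv (h : Good R st par) : X ≃ X := ⟨st, st, h.st_st, h.st_st⟩

theorem Good.sum_st (h : Good R st par) (f : X → ZMod 2) : ∑ x, f (st x) = ∑ x, f x :=
  Equiv.sum_comp (stEquiv h) f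

theorem Good.st_inj (h : Good R st par) {x y : X} : st x = st y ↔ x = y :=
  (stEquiv h).injective.eq_iff

theorem Good.rev2 (h : Good R st par) (x x' y y' : X) : R x x' y y' = R x x' (st y') (st y) := by
  rw [h.sym, h.rev, h.sym]

theorem Good.two' (h : Good R st par) (x x' y y' : X) :
    ∑ m, ∑ n, R x m n y' * R m x' y n = if x = x' ∧ y = y' then 1 else 0 := by
  have := h.two x x' (st y') (st y)
  have e : (if x = x' ∧ y = y' then (1 : ZMod 2) else 0) =
      if x = x' ∧ st y' = st y then 1 else 0 := by
    refine if_congr ?_ rfl rfl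
    rw [h.st_inj, eq_comm (a := y)]
  rw [e, ← this]
  refine Finset.sum_congr rfl fun m _ => ?_
  rw [← h.sum_st (fun n => R x m (st y') n * R m x' n (st y))]
  refine Finset.sum_congr rfl fun n _ => ?_
  rw [h.rev2 x m n y', h.rev2 m x' y n]

theorem Good.kink (h : Good R st par) (x z : X) :
    ∑ m, R x m m z = if x = z then 1 else 0 := by
  have h1 : ∀ m, R x m m z = (if par m = !par x then (if x = z then 1 else 0) else 0) +
      (if m = st x then (if x = z then 1 else 0) else 0) := by
    intro m
    by_cases hm : par m = !par x
    · rw [h.even x m m z (by rw [hm]; cases par x <;> simp)]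
      simp only [hm, if_true]
      congr 1
      · simp [eq_comm]
      · by_cases h2 : m = st x
        · subst h2; simp [h.st_st, eq_comm]
        · simp [h2]
    · have h0 : R x m m z = 0 := by
        by_contra hc; exact hm (h.hpar _ _ _ _ hc)
      have h2 : m ≠ st x := by rintro rfl; exact hm (h.par_st x)
      simp [h0, hm, h2]
  simp only [h1, Finset.sum_add_distrib]
  rw [← Finset.sum_filter, Finset.sum_const, nsmul_eq_mul, h.card]
  simp

/-- ports -/
def prt (o : Bool) (x x' u : X) : X × X := if o then (x, u) else (u, x')

def Rr (R : X → X → X → X → ZMod 2) (p q : X × X) : ZMod 2 := R p.1 p.2 q.1 q.2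

def Tri (R : X → X → X → X → ZMod 2) (o1 o2 o3 : Bool) (x1 x1' x2 x2' x3 x3' : X) : ZMod 2 :=
  ∑ u, ∑ v, ∑ w, Rr R (prt o1 x1 x1' u) (prt o2 x2 x2' v) *
    Rr R (prt (!o1) x1 x1' u) (prt o3 x3 x3' w) *
    Rr R (prt (!o2) x2 x2' v) (prt (!o3) x3 x3' w)

theorem Good.prt_rev1 (h : Good R st par) (o : Bool) (x x' u : X) (q : X × X) :
    Rr R (prt (!o) (st x') (st x) (st u)) q = Rr R (prt o x x' u) q := by
  cases o <;> simp [prt, Rr] <;> rw [← h.rev]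

theorem Good.prt_rev2 (h : Good R st par) (o : Bool) (x x' u : X) (q : X × X) :
    Rr R q (prt (!o) (st x') (st x) (st u)) = Rr R q (prt o x x' u) := by
  cases o <;> simp [prt, Rr] <;> rw [← h.rev2]

theorem Good.tri_rev1 (h : Good R st par) (o1 o2 o3 : Bool) (x1 x1' x2 x2' x3 x3' : X) :
    Tri R o1 o2 o3 x1 x1' x2 x2' x3 x3' = Tri R (!o1) o2 o3 (st x1') (st x1) x2 x2' x3 x3' := by
  unfold Tri
  conv_rhs => rw [← h.sum_st]
  simp only [h.prt_rev1]

theorem Good.tri_rev2 (h : Good R st par) (o1 o2 o3 : Bool) (x1 x1' x2 x2' x3 x3' : X) :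
    Tri R o1 o2 o3 x1 x1' x2 x2' x3 x3' = Tri R o1 (!o2) o3 x1 x1' (st x2') (st x2) x3 x3' := by
  unfold Tri
  refine Finset.sum_congr rfl fun u _ => ?_
  conv_rhs => rw [← h.sum_st]
  simp only [h.prt_rev1, h.prt_rev2]

theorem Good.tri_rev3 (h : Good R st par) (o1 o2 o3 : Bool) (x1 x1' x2 x2' x3 x3' : X) :
    Tri R o1 o2 o3 x1 x1' x2 x2' x3 x3' = Tri R o1 o2 (!o3) x1 x1' x2 x2' (st x3') (st x3) := by
  unfold Tri
  refine Finset.sum_congr rfl fun u _ => ?_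
  refine Finset.sum_congr rfl fun v _ => ?_
  conv_rhs => rw [← h.sum_st]
  simp only [h.prt_rev2]

theorem Good.rr_sym (h : Good R st par) (p q : X × X) : Rr R p q = Rr R q p := h.sym _ _ _ _

theorem Good.tri_swap (h : Good R st par) (o1 o2 o3 : Bool) (x1 x1' x2 x2' x3 x3' : X) :
    Tri R o1 o2 o3 x1 x1' x2 x2' x3 x3' = Tri R (!o1) o3 o2 x1 x1' x3 x3' x2 x2' := by
  unfold Tri
  refine Finset.sum_congr rfl fun u _ => ?_
  rw [Finset.sum_comm]
  refine Finset.sum_congr rfl fun w _ => ?_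
  refine Finset.sum_congr rfl fun v _ => ?_
  rw [h.rr_sym (prt (!o2) x2 x2' v), Bool.not_not]
  ring

theorem Good.tri_swap' (h : Good R st par) (o1 o2 o3 : Bool) (x1 x1' x2 x2' x3 x3' : X) :
    Tri R o1 o2 o3 x1 x1' x2 x2' x3 x3' = Tri R (!o3) (!o2) (!o1) x3 x3' x2 x2' x1 x1' := by
  unfold Tri
  rw [Finset.sum_comm]
  conv_rhs => rw [Finset.sum_comm]
  refine Finset.sum_congr rfl fun v _ => ?_
  rw [Finset.sum_comm]
  refine Finset.sum_congr rfl fun w _ => ?_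
  refine Finset.sum_congr rfl fun u _ => ?_
  simp only [Bool.not_not]
  rw [h.rr_sym (prt (!o2) x2 x2' v), h.rr_sym (prt (!o1) x1 x1' u), h.rr_sym (prt o1 x1 x1' u)]
  ring

theorem Good.tri_base_even (h : Good R st par) (x1 x1' x2 x2' x3 x3' : X) (hp : par x1 ≠ par x2) :
    Tri R true true true x1 x1' x2 x2' x3 x3' = Tri R false false false x1 x1' x2 x2' x3 x3' := by
  have hp' : par x2 = !par x1 := by revert hp; cases par x1 <;> cases par x2 <;> simp
  simp only [Tri, prt, Rr, Bool.not_true, Bool.not_false, if_true, if_false, Bool.false_eq_true]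
  have L : ∀ u v w, R x1 u x2 v * R u x1' x3 w * R v x2' w x3' =
      (if u = x2 then (if v = x1 then R x2 x1' x3 w * R x1 x2' w x3' else 0) else 0) +
      (if v = st u then (if x2 = st x1 ∧ par x1' = par x1 then
        R (st x2') u w x3' * R u x1' x3 w else 0) else 0) := by
    intro u v w
    by_cases hz : R u x1' x3 w = 0
    · rw [hz]
      by_cases h1 : u = x2
      · subst h1; simp [hz]
      · simp [h1]
    have hu := h.hpar _ _ _ _ hz
    rw [h.even x1 u x2 v hp]
    by_cases hpu : par u = !par x1
    · rw [if_pos hpu, add_mul, add_mul]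
      congr 1
      · by_cases h1 : u = x2 <;> by_cases h2 : v = x1 <;> simp [h1, h2]
      · have : par x1' = par x1 := by rw [hu, hpu, Bool.not_not]
        by_cases h2 : v = st u
        · subst h2
          rw [h.rev (st u) x2' w x3', h.st_st]
          by_cases h3 : x2 = st x1 <;> simp [h3, this] ; ring
        · simp [h2]
    · rw [if_neg hpu]
      have h1 : u ≠ x2 := by rintro rfl; exact hpu hp'
      have h2 : par x1' ≠ par x1 := by
        rw [hu]; revert hpu; cases par u <;> cases par x1 <;> simp
      simp [h1, h2]
  have L' : ∀ u v w, R u x1' v x2' * R x1 u w x3' * R x2 v x3 w =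
      (if u = x2' then (if v = x1' then R x2 x1' x3 w * R x1 x2' w x3' else 0) else 0) +
      (if v = st u then (if x2' = st x1' ∧ par x1' = par x1 then
        R x1 u w x3' * R u (st x2) x3 w else 0) else 0) := by
    intro u v w
    by_cases hz : R x1 u w x3' = 0
    · rw [hz]
      by_cases h1 : u = x2'
      · subst h1; simp [hz]
      · simp [h1]
    have hu := h.hpar _ _ _ _ hz
    by_cases hz' : R x2 v x3 w = 0
    · rw [hz']
      by_cases h1 : v = st u
      · subst h1
        have := h.rev x2 (st u) x3 w
        rw [h.st_st, hz'] at this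
        rw [← this]
        by_cases h2 : st u = x1'
        · rw [← h2, hz']; simp
        · simp [h2]
      · by_cases h2 : v = x1'
        · rw [← h2, hz']; simp [h1]
        · simp [h1, h2]
    have hv := h.hpar _ _ _ _ hz'
    have hne : par u ≠ par v := by rw [hu, hv, hp']; cases par x1 <;> simp
    rw [h.even u x1' v x2' hne]
    by_cases hpu : par x1' = !par u
    · rw [if_pos hpu, add_mul, add_mul]
      congr 1
      · have ec : (x1' = v ∧ x2' = u) ↔ (u = x2' ∧ v = x1') := by
          constructor <;> rintro ⟨rfl, rfl⟩ <;> exact ⟨rfl, rfl⟩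
        rw [if_congr ec rfl rfl]
        by_cases h1 : u = x2'
        · by_cases h2 : v = x1'
          · subst h1 h2; simp; ring
          · simp [h2]
        · simp [h1]
      · have : par x1' = par x1 := by rw [hpu, hu, Bool.not_not]
        by_cases h2 : v = st u
        · subst h2
          rw [h.rev x2 (st u) x3 w, h.st_st]
          by_cases h3 : x2' = st x1' <;> simp [h3, this]
        · simp [h2]
    · rw [if_neg hpu]
      have h1 : v ≠ x1' := by
        rintro rfl; revert hne hpu; cases par u <;> cases par v <;> simp
      have h2 : par x1' ≠ par x1 := by
        intro h3; apply hpu; rw [h3, hu, Bool.not_not]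
      simp [h1, h2]
  simp only [L, L', Finset.sum_add_distrib]
  congr 1
  · have e0 : ∀ (a b : X) (f : X → ZMod 2),
        (∑ u, ∑ v, ∑ w, if u = a then (if v = b then f w else 0) else 0) = ∑ w, f w := by
      intro a b f
      rw [Finset.sum_eq_single a, Finset.sum_eq_single b]
      · simp
      · intro c _ hc; simp [hc]
      · simp
      · intro c _ hc; simp [hc]
      · simp
    rw [e0, e0]
  · have e1 : ∀ (c : Prop) [Decidable c] (f : X → X → ZMod 2),
        (∑ u, ∑ v, ∑ w, if v = st u then (if c then f u w else 0) else 0) =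
        if c then ∑ u, ∑ w, f u w else 0 := by
      intro c _ f
      by_cases hc : c
      · simp only [hc, if_true]
        refine Finset.sum_congr rfl fun u _ => ?_
        rw [Finset.sum_comm]
        refine Finset.sum_congr rfl fun w _ => ?_
        simp
      · simp [hc]
    rw [e1, e1, h.two', h.two']
    rw [← ite_and, ← ite_and]
    refine if_congr ?_ rfl rfl
    constructor
    · rintro ⟨⟨rfl, h2⟩, h3, rfl⟩
      exact ⟨⟨by rw [← h3, h.st_st], h2⟩, by rw [h.st_st], rfl⟩
    · rintro ⟨⟨rfl, h2⟩, h3, rfl⟩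
      exact ⟨⟨by rw [h3, h.st_st], h2⟩, by rw [h.st_st], rfl⟩

theorem Good.tri_zero (h : Good R st par) (o1 o2 o3 : Bool) (x1 x1' x2 x2' x3 x3' : X)
    (hp : par x1' ≠ par x1) : Tri R o1 o2 o3 x1 x1' x2 x2' x3 x3' = 0 := by
  unfold Tri
  refine Finset.sum_eq_zero fun u _ => Finset.sum_eq_zero fun v _ => Finset.sum_eq_zero fun w _ => ?_
  by_contra hc
  have h1 := left_ne_zero_of_mul (left_ne_zero_of_mul hc)
  have h2 := right_ne_zero_of_mul (left_ne_zero_of_mul hc)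
  have h1 := h.hpar _ _ _ _ h1
  have h2 := h.hpar _ _ _ _ h2
  apply hp
  cases o1 <;> simp [prt] at h1 h2 <;> simp [h1, h2]

theorem Good.tri_base (h : Good R st par) (x1 x1' x2 x2' x3 x3' : X) :
    Tri R true true true x1 x1' x2 x2' x3 x3' = Tri R false false false x1 x1' x2 x2' x3 x3' := by
  by_cases h1 : par x1' = par x1
  swap
  · rw [h.tri_zero _ _ _ _ _ _ _ _ _ h1, h.tri_zero _ _ _ _ _ _ _ _ _ h1]
  by_cases h2 : par x1 = par x2
  swap
  · exact h.tri_base_even _ _ _ _ _ _ h2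
  by_cases h3 : par x1 = par x3
  · rw [h.tri_swap, h.tri_rev1, h.tri_swap false, h.tri_rev1 (!false)]
    refine h.tri_base_even _ _ _ _ _ _ ?_
    rw [h.par_st, h1, h3]; cases par x3 <;> simp
  · rw [h.tri_swap' true, h.tri_swap' false]
    refine (h.tri_base_even _ _ _ _ _ _ ?_).symm
    rw [← h2]; exact Ne.symm h3

theorem Good.tri (h : Good R st par) (o1 o2 o3 : Bool) (x1 x1' x2 x2' x3 x3' : X) :
    Tri R o1 o2 o3 x1 x1' x2 x2' x3 x3' = Tri R (!o1) (!o2) (!o3) x1 x1' x2 x2' x3 x3' := by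
  have H1 : ∀ o1 x1 x1' x2 x2' x3 x3',
      Tri R o1 true true x1 x1' x2 x2' x3 x3' = Tri R (!o1) false false x1 x1' x2 x2' x3 x3' := by
    intro o1 x1 x1' x2 x2' x3 x3'
    cases o1
    · exact (h.tri_rev1 false true true x1 x1' x2 x2' x3 x3').trans
        ((h.tri_base (st x1') (st x1) x2 x2' x3 x3').trans
          (h.tri_rev1 true false false x1 x1' x2 x2' x3 x3').symm)
    · exact h.tri_base _ _ _ _ _ _
  have H2 : ∀ o1 o2 x1 x1' x2 x2' x3 x3',
      Tri R o1 o2 true x1 x1' x2 x2' x3 x3' = Tri R (!o1) (!o2) false x1 x1' x2 x2' x3 x3' := by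
    intro o1 o2 x1 x1' x2 x2' x3 x3'
    cases o2
    · exact (h.tri_rev2 o1 false true x1 x1' x2 x2' x3 x3').trans
        ((H1 o1 x1 x1' (st x2') (st x2) x3 x3').trans
          (h.tri_rev2 (!o1) true false x1 x1' x2 x2' x3 x3').symm)
    · exact H1 _ _ _ _ _ _ _
  cases o3
  · exact (h.tri_rev3 o1 o2 false x1 x1' x2 x2' x3 x3').trans
        ((H2 o1 o2 x1 x1' x2 x2' (st x3') (st x3)).trans
          (h.tri_rev3 (!o1) (!o2) true x1 x1' x2 x2' x3 x3').symm)
  · exact H2 _ _ _ _ _ _ _ _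

end

abbrev X := Fin 24 × Bool × Bool

def tau (i : Fin 24) : Fin 24 :=
  (![2, 7, 0, 11, 6, 9, 4, 1, 10, 5, 8, 3, 16, 21, 18, 23, 12, 19, 14, 17, 22, 13, 20, 15] : Fin 24 → Fin 24) i

def par (x : X) : Bool := x.2.2
def st (x : X) : X := (x.1, !x.2.1, !x.2.2)
def idle (x : X) : X := (x.1, x.2.1, !x.2.2)
def adv (x : X) : X := (if x.2.1 then x.1 + 1 else x.1 - 1, x.2.1, !x.2.2)
def idx (x : X) : Fin 24 := if x.2.1 then x.1 else x.1 - 1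

theorem tau_tau : ∀ i, tau (tau i) = i := by decide
theorem tau_irr : ∀ i, tau (i + 1) ≠ tau i + 1 ∧ tau (i + 1) ≠ tau i - 1 := by decide
theorem tau_irr2 : ∀ i, tau (i - 1) ≠ tau i + 1 ∧ tau (i - 1) ≠ tau i - 1 := by decide

theorem st_st : ∀ x, st (st x) = x := by decide
theorem par_st (x : X) : par (st x) = !par x := rfl
theorem par_idle (x : X) : par (idle x) = !par x := rfl
theorem par_adv (x : X) : par (adv x) = !par x := rfl
theorem idle_idle : ∀ x, idle (idle x) = x := by decide
theorem idle_adv : ∀ x, idle (adv x) = adv (idle x) := by decide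
theorem idx_idle (x : X) : idx (idle x) = idx x := rfl
theorem st_idle : ∀ x, st (idle x) = idle (st x) := by decide
theorem adv_st_adv : ∀ x, adv (st (adv x)) = st x := by decide
theorem idx_st_adv : ∀ x, idx (st (adv x)) = idx x := by decide
theorem card_par : ∀ p : Bool, ((Finset.univ.filter fun x : X => par x = p).card : ZMod 2) = 0 := by
  decide

theorem adv_adv_irr : ∀ x y, idx y = tau (idx x) → idx (adv y) ≠ tau (idx (adv x)) := by
  rintro ⟨z, d, p⟩ ⟨w, e, q⟩ h
  have h1 := tau_irr z
  have h2 := tau_irr2 (z - 1)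
  have h3 := tau_irr (z - 1)
  have h4 := tau_irr2 z
  cases d <;> cases e <;> simp only [idx, adv, if_true, if_false, Bool.false_eq_true] at h ⊢
  · rw [h]; exact h2.2.symm
  · rw [h]; exact h2.1.symm
  · have : w - 1 - 1 = tau z - 1 := by rw [h]
    rw [this]; exact h1.2.symm
  · rw [h]; exact h1.1.symm

abbrev ind (p : Prop) [Decidable p] : ZMod 2 := if p then 1 else 0

def R (x x' y y' : X) : ZMod 2 :=
  (if par x = par y then
    ind (x' = idle x ∧ y' = idle y) + ind (x' = adv x ∧ y' = adv y ∧ idx y = tau (idx x)) else 0) +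
  (if par x' = !par x then
    ind (x' = y ∧ y' = x) + ind (y = st x ∧ y' = st x') else 0)

theorem R_odd (x x' y y' : X) (h : par x = par y) : R x x' y y' =
    ind (x' = idle x ∧ y' = idle y) + ind (x' = adv x ∧ y' = adv y ∧ idx y = tau (idx x)) := by
  unfold R
  rw [if_pos h]
  by_cases h1 : par x' = !par x
  · have h2 : ¬ (x' = y ∧ y' = x) := by
      rintro ⟨rfl, -⟩; rw [← h] at h1; revert h1; cases par x <;> simp
    have h3 : ¬ (y = st x ∧ y' = st x') := by
      rintro ⟨rfl, -⟩; rw [par_st] at h; revert h; cases par x <;> simp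
    simp [h2, h3]
  · rw [if_neg h1, add_zero]

theorem R_even (x x' y y' : X) (h : par x ≠ par y) : R x x' y y' =
  (if par x' = !par x then
    ind (x' = y ∧ y' = x) + ind (y = st x ∧ y' = st x') else 0) := by
  unfold R
  rw [if_neg h, zero_add]

theorem R_par (x x' y y' : X) (h : R x x' y y' ≠ 0) : par x' = !par x := by
  by_contra hc
  apply h
  have h1 : x' ≠ idle x := by rintro rfl; exact hc (par_idle x)
  have h2 : x' ≠ adv x := by rintro rfl; exact hc (par_adv x)
  simp [R, h1, h2, hc]

theorem R_par2 (x x' y y' : X) (h : R x x' y y' ≠ 0) : par y' = !par y := by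
  by_contra hc
  apply h
  have h1 : y' ≠ idle y := by rintro rfl; exact hc (par_idle y)
  have h2 : y' ≠ adv y := by rintro rfl; exact hc (par_adv y)
  unfold R
  by_cases hp : par x' = !par x
  · have h3 : ¬ (x' = y ∧ y' = x) := by
      rintro ⟨rfl, rfl⟩; apply hc; rw [hp, Bool.not_not]
    have h4 : ¬ (y = st x ∧ y' = st x') := by
      rintro ⟨rfl, rfl⟩; apply hc; rw [par_st, par_st, hp]
    simp [h1, h2, h3, h4]
  · simp [h1, h2, hp]

theorem R_sym (x x' y y' : X) : R x x' y y' = R y y' x x' := by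
  by_cases hn : par x' = !par x ∧ par y' = !par y
  swap
  · have : R x x' y y' = 0 := by
      by_contra h; exact hn ⟨R_par _ _ _ _ h, R_par2 _ _ _ _ h⟩
    rw [this]; symm
    by_contra h; exact hn ⟨R_par2 _ _ _ _ h, R_par _ _ _ _ h⟩
  unfold R
  rw [if_pos hn.1, if_pos hn.2]
  congr 1
  · refine if_congr eq_comm ?_ rfl
    congr 1
    · exact if_congr and_comm rfl rfl
    · refine if_congr ?_ rfl rfl
      constructor
      · rintro ⟨h1, h2, h3⟩; exact ⟨h2, h1, by rw [h3, tau_tau]⟩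
      · rintro ⟨h1, h2, h3⟩; exact ⟨h2, h1, by rw [h3, tau_tau]⟩
  · congr 1
    · refine if_congr ?_ rfl rfl
      constructor <;> rintro ⟨rfl, rfl⟩ <;> exact ⟨rfl, rfl⟩
    · refine if_congr ?_ rfl rfl
      constructor <;> rintro ⟨rfl, rfl⟩ <;> simp [st_st]

theorem R_rev (x x' y y' : X) : R x x' y y' = R (st x') (st x) y y' := by
  by_cases hn : par x' = !par x
  swap
  · have : R x x' y y' = 0 := by
      by_contra h; exact hn (R_par _ _ _ _ h)
    rw [this]; symm
    by_contra h
    have := R_par _ _ _ _ h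
    rw [par_st, par_st] at this
    apply hn; revert this; cases par x <;> cases par x' <;> simp
  have hs : par (st x') = par x := by rw [par_st, hn, Bool.not_not]
  have hs' : par (st x) = !par (st x') := by rw [hs, par_st]
  unfold R
  rw [if_pos hn, if_pos hs', hs]
  congr 1
  · refine if_congr Iff.rfl ?_ rfl
    congr 1
    · refine if_congr ?_ rfl rfl
      constructor
      · rintro ⟨rfl, rfl⟩
        refine ⟨?_, rfl⟩
        rw [← st_idle, idle_idle]
      · rintro ⟨h, rfl⟩
        refine ⟨?_, rfl⟩
        rw [← st_idle] at h
        have := congrArg st h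
        rw [st_st, st_st] at this
        rw [this, idle_idle]
    · refine if_congr ?_ rfl rfl
      constructor
      · rintro ⟨rfl, rfl, h⟩
        exact ⟨(adv_st_adv x).symm, rfl, by rw [idx_st_adv, h]⟩
      · rintro ⟨h1, rfl, h⟩
        have h2 : x' = adv x := by
          have := adv_st_adv (st x')
          rw [← h1, st_st, st_st] at this
          exact this.symm
        refine ⟨h2, rfl, ?_⟩
        rw [h, h2, idx_st_adv]
  · rw [add_comm]
    congr 1
    · refine if_congr ?_ rfl rfl
      constructor
      · rintro ⟨h1, h2⟩; exact ⟨h1.symm, h2⟩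
      · rintro ⟨h1, h2⟩; exact ⟨h1.symm, h2⟩
    · refine if_congr ?_ rfl rfl
      rw [st_st, st_st]
      constructor <;> rintro ⟨rfl, rfl⟩ <;> exact ⟨rfl, rfl⟩

theorem ite_sum2 (c : Prop) [Decidable c] (a b : X) (F : X → X → ZMod 2) :
    (∑ m, ∑ n, ind (m = a ∧ n = b ∧ c) * F m n) = if c then F a b else 0 := by
  rw [Finset.sum_eq_single a, Finset.sum_eq_single b]
  · simp
  · intro d _ hd; simp [hd]
  · simp
  · intro d _ hd; simp [hd]
  · simp

theorem ite_sum2' (a b : X) (F : X → X → ZMod 2) :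
    (∑ m, ∑ n, ind (m = a ∧ n = b) * F m n) = F a b := by
  rw [Finset.sum_eq_single a, Finset.sum_eq_single b]
  · simp
  · intro d _ hd; simp [hd]
  · simp
  · intro d _ hd; simp [hd]
  · simp

theorem z2 (a : ZMod 2) : a + a = 0 := CharTwo.add_self_eq_zero a

theorem R_two (x x' y y' : X) :
    ∑ m, ∑ n, R x m y n * R m x' n y' = if x = x' ∧ y = y' then 1 else 0 := by
  by_cases h : par x = par y
  · have e : ∀ m n, R x m y n * R m x' n y' =
        ind (m = idle x ∧ n = idle y) * R m x' n y' +
        ind (m = adv x ∧ n = adv y ∧ idx y = tau (idx x)) * R m x' n y' := by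
      intro m n; rw [R_odd _ _ _ _ h, add_mul]
    simp only [e, Finset.sum_add_distrib]
    rw [ite_sum2, ite_sum2', R_odd (idle x) _ _ _ (by rw [par_idle, par_idle, h]),
      R_odd (adv x) _ _ _ (by rw [par_adv, par_adv, h])]
    rw [idle_idle, idle_idle, idle_adv, idle_adv, idx_idle, idx_idle]
    have e1 : ind (x = x' ∧ y = y') = ind (x' = x ∧ y' = y) := by
      refine if_congr ?_ rfl rfl
      constructor <;> rintro ⟨rfl, rfl⟩ <;> exact ⟨rfl, rfl⟩
    change _ = ind (x = x' ∧ y = y')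
    rw [e1]
    by_cases hc : idx y = tau (idx x)
    · have := adv_adv_irr x y hc
      simp only [hc, this, and_true, and_false, if_true, if_false, add_zero]
      rw [add_assoc, z2, add_zero]
    · simp [hc]
  · have hp : par y = !par x := by revert h; cases par x <;> cases par y <;> simp
    have e : ∀ m n, R x m y n * R m x' n y' =
        ind (m = y ∧ n = x) * R m x' n y' +
        (if n = st m then (if par m = !par x then ind (y = st x) * R m x' (st m) y' else 0) else 0) := by
      intro m n
      rw [R_even _ _ _ _ h]
      by_cases hm : par m = !par x
      · rw [if_pos hm, if_pos hm, add_mul]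
        congr 1
        by_cases hn : n = st m
        · subst hn; simp
        · simp [hn]
      · have : m ≠ y := by rintro rfl; exact hm hp
        simp [hm, this]
    simp only [e, Finset.sum_add_distrib]
    rw [ite_sum2']
    simp only [Finset.sum_ite_eq', Finset.mem_univ, if_true]
    rw [R_even y x' x y' (Ne.symm h)]
    have e2 : ∀ m, (if par m = !par x then ind (y = st x) * R m x' (st m) y' else 0) =
        (if m = y' then (if par m = !par x then ind (y = st x ∧ par x' = par x ∧ y' = st x') else 0) else 0)
          + (if par m = !par x then ind (y = st x ∧ par x' = par x ∧ y' = st x') else 0) := by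
      intro m
      by_cases hm : par m = !par x
      · simp only [hm, if_true]
        rw [R_even m x' (st m) y' (by rw [par_st]; cases par m <;> simp), hm, Bool.not_not]
        by_cases h1 : y = st x
        · by_cases h2 : par x' = par x
          · simp only [h1, h2, if_true, true_and, one_mul]
            congr 1
            by_cases h3 : m = y'
            · subst h3
              simp only [and_true, if_true]
              refine if_congr ?_ rfl rfl
              constructor
              · rintro rfl; rw [st_st]
              · rintro rfl; rw [st_st]
            · have h4 : y' ≠ m := Ne.symm h3
              simp [h3, h4]
          · simp [h2]
        · simp [h1]
      · simp [hm]
    simp only [e2, Finset.sum_add_distrib]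
    rw [← Finset.sum_filter (fun m => par m = !par x), Finset.sum_const, nsmul_eq_mul, card_par,
      zero_mul, add_zero]
    simp only [Finset.sum_ite_eq', Finset.mem_univ, if_true, hp, Bool.not_not]
    by_cases h2 : par x' = par x
    · simp only [h2, if_true, true_and]
      have h3 : (x = st y ∧ y' = st x') ↔ (y = st x ∧ y' = st x') := by
        constructor
        · rintro ⟨rfl, rfl⟩; simp [st_st]
        · rintro ⟨rfl, rfl⟩; simp [st_st]
      have h4 : (if par y' = !par x then ind (y = st x ∧ y' = st x') else 0) = ind (y = st x ∧ y' = st x') := by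
        by_cases h5 : y = st x ∧ y' = st x'
        · have : par y' = !par x := by rw [h5.2, par_st, h2]
          simp [this]
        · simp [h5]
      rw [h4, add_assoc]
      simp only [ind]
      rw [if_congr h3 rfl rfl, z2, add_zero]
      refine if_congr ?_ rfl rfl
      constructor <;> rintro ⟨rfl, rfl⟩ <;> exact ⟨rfl, rfl⟩
    · have h3 : ¬ (x = x' ∧ y = y') := by rintro ⟨rfl, rfl⟩; exact h2 rfl
      simp [h2, h3]

theorem good : Good R st par where
  st_st := st_st
  par_st := par_st
  card := card_par
  sym := R_sym
  rev := R_rev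
  hpar := R_par
  even := fun x x' y y' h => R_even x x' y y' h
  two := R_two

abbrev Kap := (Bool × Option (Fin 24)) ⊕ (Bool × X × X)

def M : Kap → Bool → X → X → ZMod 2
  | .inl (p, none), _, x, z => ind (par x = p ∧ z = idle x)
  | .inl (p, some i), s, x, z => ind (par x = p ∧ z = adv x ∧ idx x = if s then tau i else i)
  | .inr (false, u, v), s, x, z =>
      ind (par v = !par u ∧ if s then x = v ∧ z = u else x = u ∧ z = v)
  | .inr (true, u, v), s, x, z =>
      ind (par v = !par u ∧ if s then x = st u ∧ z = st v else x = u ∧ z = v)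

theorem ind_mul (p q : Prop) [Decidable p] [Decidable q] : ind p * ind q = ind (p ∧ q) := by
  by_cases p <;> by_cases q <;> simp [*]

theorem sum_ind_u {Y : Type} [Fintype Y] [DecidableEq Y] (a : Y) (p : Y → Prop) [DecidablePred p]
    (q : Prop) [Decidable q] (h : ∀ y, p y ↔ (y = a ∧ q)) : ∑ y, ind (p y) = ind q := by
  rw [Finset.sum_eq_single a]
  · exact if_congr (by rw [h]; simp) rfl rfl
  · intro b _ hb; exact if_neg (by rw [h]; simp [hb])
  · simp

theorem sumM_false (x x' y y' : X) : ∑ κ, M κ false x x' * M κ true y y' = R x x' y y' := by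
  have h1 : ∑ p : Bool, M (.inl (p, none)) false x x' * M (.inl (p, none)) true y y' =
      ind (par x = par y ∧ x' = idle x ∧ y' = idle y) := by
    simp only [M, ind_mul]
    refine sum_ind_u (par x) _ _ fun p => ?_
    constructor
    · rintro ⟨⟨rfl, h1⟩, h2, h3⟩; exact ⟨rfl, h2.symm, h1, h3⟩
    · rintro ⟨rfl, h2, h1, h3⟩; exact ⟨⟨rfl, h1⟩, h2.symm, h3⟩
  have h2 : ∑ q : Bool × Fin 24, M (.inl (q.1, some q.2)) false x x' *
      M (.inl (q.1, some q.2)) true y y' =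
      ind (par x = par y ∧ x' = adv x ∧ y' = adv y ∧ idx y = tau (idx x)) := by
    simp only [M, ind_mul, if_true, if_false, Bool.false_eq_true]
    refine sum_ind_u (par x, idx x) _ _ fun p => ?_
    obtain ⟨p, i⟩ := p
    simp only [Prod.mk.injEq]
    constructor
    · rintro ⟨⟨rfl, h1, rfl⟩, h2, h3, h4⟩; exact ⟨⟨rfl, rfl⟩, h2.symm, h1, h3, h4⟩
    · rintro ⟨⟨rfl, rfl⟩, h2, h1, h3, h4⟩; exact ⟨⟨rfl, h1, rfl⟩, h2.symm, h3, h4⟩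
  have h3 : ∑ q : X × X, M (.inr (false, q)) false x x' * M (.inr (false, q)) true y y' =
      ind (par x' = (!par x) ∧ x' = y ∧ y' = x) := by
    simp only [M, ind_mul, if_true, if_false, Bool.false_eq_true]
    refine sum_ind_u (x, x') _ _ fun p => ?_
    obtain ⟨u, v⟩ := p
    simp only [Prod.mk.injEq]
    constructor
    · rintro ⟨⟨h, rfl, rfl⟩, _, h3, h4⟩; exact ⟨⟨rfl, rfl⟩, h, h3.symm, h4⟩
    · rintro ⟨⟨rfl, rfl⟩, h, h3, h4⟩; exact ⟨⟨h, rfl, rfl⟩, h, h3.symm, h4⟩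
  have h4 : ∑ q : X × X, M (.inr (true, q)) false x x' * M (.inr (true, q)) true y y' =
      ind (par x' = (!par x) ∧ y = st x ∧ y' = st x') := by
    simp only [M, ind_mul, if_true, if_false, Bool.false_eq_true]
    refine sum_ind_u (x, x') _ _ fun p => ?_
    obtain ⟨u, v⟩ := p
    simp only [Prod.mk.injEq]
    constructor
    · rintro ⟨⟨h, rfl, rfl⟩, _, h3, h4⟩; exact ⟨⟨rfl, rfl⟩, h, h3, h4⟩
    · rintro ⟨⟨rfl, rfl⟩, h, h3, h4⟩; exact ⟨⟨h, rfl, rfl⟩, h, h3, h4⟩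
  have e1 : ∀ f : Bool × Option (Fin 24) → ZMod 2,
      ∑ q, f q = ∑ p, f (p, none) + ∑ q : Bool × Fin 24, f (q.1, some q.2) := by
    intro f
    rw [Fintype.sum_prod_type, Fintype.sum_prod_type, ← Finset.sum_add_distrib]
    refine Finset.sum_congr rfl fun p _ => ?_
    rw [Fintype.sum_option]
  have e2 : ∀ f : Bool × X × X → ZMod 2,
      ∑ q, f q = ∑ q, f (false, q) + ∑ q, f (true, q) := by
    intro f
    rw [Fintype.sum_prod_type, Fintype.sum_bool, add_comm]
  rw [Fintype.sum_sum_type, e1, e2, h1, h2, h3, h4]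
  have e3 : ∀ (a b c : Prop) [Decidable a] [Decidable b] [Decidable c],
      ind (a ∧ b) + ind (a ∧ c) = if a then ind b + ind c else 0 := by
    intro a b c _ _ _
    by_cases a <;> simp [*]
  rw [e3, e3, R]

theorem sumM (s : Bool) (x x' y y' : X) : ∑ κ, M κ s x x' * M κ (!s) y y' = R x x' y y' := by
  cases s
  · exact sumM_false x x' y y'
  · rw [R_sym, ← sumM_false]
    refine Finset.sum_congr rfl fun κ _ => ?_
    exact mul_comm _ _

abbrev Mat := Matrix X X (ZMod 2)

def letter (ρ : ℕ → Kap) (e : Endpoint) : Mat := Matrix.of (M (ρ e.1) e.2)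

def wd (ρ : ℕ → Kap) (D : GDiagram) : Mat := (D.map (letter ρ)).prod

theorem wd_append (ρ : ℕ → Kap) (D E : GDiagram) : wd ρ (D ++ E) = wd ρ D * wd ρ E := by
  simp [wd]

theorem wd_nil (ρ : ℕ → Kap) : wd ρ [] = 1 := rfl
theorem wd_cons (ρ : ℕ → Kap) (e) (D : GDiagram) : wd ρ (e :: D) = letter ρ e * wd ρ D := by
  simp [wd]

theorem wd_update (ρ : ℕ → Kap) (a : ℕ) (κ : Kap) (D : GDiagram) (h : ∀ e ∈ D, e.1 ≠ a) :
    wd (Function.update ρ a κ) D = wd ρ D := by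
  unfold wd
  congr 1
  refine List.map_congr_left fun e he => ?_
  simp [letter, h e he]

def trp (p : Bool) : Mat →+ ZMod 2 where
  toFun A := ∑ x, if par x = p then A x x else 0
  map_zero' := by simp
  map_add' A B := by
    rw [← Finset.sum_add_distrib]
    refine Finset.sum_congr rfl fun x _ => ?_
    split_ifs <;> simp

theorem trp_apply (p : Bool) (A : Mat) : trp p A = ∑ x, if par x = p then A x x else 0 := by
  unfold trp
  exact Eq.refl _

def S {β : Type} [AddCommMonoid β] (a : ℕ) (G : (ℕ → Kap) → β) : (ℕ → Kap) → β :=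
  fun ρ => ∑ κ, G (Function.update ρ a κ)

theorem S_comm {β : Type} [AddCommMonoid β] (a b : ℕ) (G : (ℕ → Kap) → β) :
    S a (S b G) = S b (S a G) := by
  by_cases h : a = b
  · rw [h]
  funext ρ
  unfold S
  rw [Finset.sum_comm]
  simp only [Function.update_comm h]

instance {β : Type} [AddCommMonoid β] : LeftCommutative (S (β := β)) := ⟨S_comm⟩

def SS {β : Type} [AddCommMonoid β] (L : List ℕ) (G : (ℕ → Kap) → β) : (ℕ → Kap) → β :=
  L.foldr S G

theorem SS_nil {β : Type} [AddCommMonoid β] (G : (ℕ → Kap) → β) : SS [] G = G := rfl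

theorem SS_cons {β : Type} [AddCommMonoid β] (a : ℕ) (L : List ℕ) (G : (ℕ → Kap) → β)
    (ρ : ℕ → Kap) : SS (a :: L) G ρ = ∑ κ, SS L G (Function.update ρ a κ) := by
  unfold SS
  rw [List.foldr_cons]
  unfold S
  exact Eq.refl _

theorem SS_perm {β : Type} [AddCommMonoid β] {L L' : List ℕ} (h : L.Perm L')
    (G : (ℕ → Kap) → β) : SS L G = SS L' G := h.foldr_eq G

theorem SS_append {β : Type} [AddCommMonoid β] (L L' : List ℕ)
    (G : (ℕ → Kap) → β) : SS (L ++ L') G = SS L (SS L' G) := List.foldr_append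

theorem SS_map {β γ : Type} [AddCommMonoid β] [AddCommMonoid γ] (f : β →+ γ) (L : List ℕ)
    (G : (ℕ → Kap) → β) (ρ : ℕ → Kap) : SS L (fun ρ => f (G ρ)) ρ = f (SS L G ρ) := by
  induction L generalizing ρ with
  | nil => rfl
  | cons a L ih =>
    rw [SS_cons, SS_cons, map_sum]
    exact Finset.sum_congr rfl fun κ _ => ih _

def heads (D : GDiagram) : List ℕ := (D.filter (·.2)).map (·.1)

theorem heads_perm {D D' : GDiagram} (h : D.Perm D') : (heads D).Perm (heads D') :=
  (h.filter _).map _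

theorem heads_append (D D' : GDiagram) : heads (D ++ D') = heads D ++ heads D' := by
  simp [heads]

theorem heads_pair (a : ℕ) (s : Bool) (D : GDiagram) :
    heads ((a, s) :: (a, !s) :: D) = a :: heads D := by
  cases s <;> simp [heads]

def Z (p : Bool) (D : GDiagram) : (ℕ → Kap) → ZMod 2 :=
  SS (heads D) (fun ρ => trp p (wd ρ D))

def Q (D : GDiagram) : Prop := ∀ p ρ, Z p D ρ = 0

theorem Q_nil : Q [] := by
  intro p ρ
  have : Z p [] ρ = ((Finset.univ.filter fun x : X => par x = p).card : ZMod 2) := by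
    unfold Z
    rw [show heads [] = [] from rfl, SS_nil, wd_nil, trp_apply]
    simp
  rw [this, card_par]

theorem Z_local {D D' : GDiagram} {H C C' : List ℕ} (h : (heads D).Perm (H ++ C))
    (h' : (heads D').Perm (H ++ C'))
    (hw : ∀ ρ, SS C (fun ρ => wd ρ D) ρ = SS C' (fun ρ => wd ρ D') ρ) (p : Bool) :
    Z p D = Z p D' := by
  unfold Z
  rw [SS_perm h, SS_perm h', SS_append, SS_append]
  have e : SS C (fun ρ => trp p (wd ρ D)) = SS C' (fun ρ => trp p (wd ρ D')) := by
    funext ρ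
    rw [SS_map (trp p), SS_map (trp p), hw]
  rw [e]

theorem Q_local {D D' : GDiagram} {H C C' : List ℕ} (h : (heads D).Perm (H ++ C))
    (h' : (heads D').Perm (H ++ C'))
    (hw : ∀ ρ, SS C (fun ρ => wd ρ D) ρ = SS C' (fun ρ => wd ρ D') ρ) : Q D ↔ Q D' := by
  unfold Q
  simp only [Z_local h h' hw]

theorem M_par (κ : Kap) (s : Bool) (x z : X) (h : M κ s x z ≠ 0) : par z = !par x := by
  have aux : ∀ (q : Prop) [Decidable q], ind q ≠ 0 → q := by
    intro q _ hq; by_contra hc; exact hq (if_neg hc)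
  rcases κ with ⟨p, _ | i⟩ | ⟨_ | _, u, v⟩
  · have := aux _ h; rw [this.2, par_idle]
  · have := aux _ h; rw [this.2.1, par_adv]
  · have := aux _ h
    obtain ⟨h1, h2⟩ := this
    cases s
    · simp at h2; rw [h2.1, h2.2, h1]
    · simp at h2; rw [h2.1, h2.2, h1, Bool.not_not]
  · have := aux _ h
    obtain ⟨h1, h2⟩ := this
    cases s
    · simp at h2; rw [h2.1, h2.2, h1]
    · simp at h2; rw [h2.1, h2.2, par_st, par_st, h1]

def flipn : ℕ → Bool → Bool
  | 0, b => b
  | n + 1, b => flipn n (!b)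

theorem flipn_flipn (n : ℕ) (b : Bool) : flipn n (flipn n b) = b := by
  have h : ∀ n b, flipn n (!b) = !flipn n b := by
    intro n; induction n with
    | zero => intro b; rfl
    | succ n ih => intro b; simp [flipn, ih]
  induction n generalizing b with
  | zero => rfl
  | succ n ih => simp [flipn, h, ih]

theorem wd_par (ρ : ℕ → Kap) (D : GDiagram) (x y : X) (h : wd ρ D x y ≠ 0) :
    par y = flipn D.length (par x) := by
  induction D generalizing x with
  | nil =>
    rw [wd_nil] at h
    have : x = y := by by_contra hc; exact h (Matrix.one_apply_ne hc)
    rw [this]; rfl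
  | cons e D ih =>
    rw [wd_cons, Matrix.mul_apply] at h
    obtain ⟨z, -, hz⟩ := Finset.exists_ne_zero_of_sum_ne_zero h
    have h1 := M_par _ _ _ _ (left_ne_zero_of_mul hz)
    have h2 := ih z (right_ne_zero_of_mul hz)
    rw [h2, h1]; rfl

theorem trp_rot (ρ : ℕ → Kap) (u v : GDiagram) (p : Bool) :
    trp p (wd ρ (u ++ v)) = trp (flipn u.length p) (wd ρ (v ++ u)) := by
  rw [wd_append, wd_append]
  rw [trp_apply, trp_apply]
  have e1 : ∀ x, (if par x = p then (wd ρ u * wd ρ v) x x else 0) =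
      ∑ y, if par x = p then wd ρ u x y * wd ρ v y x else 0 := by
    intro x; split_ifs
    · rw [Matrix.mul_apply]
    · simp
  have e2 : ∀ y, (if par y = flipn u.length p then (wd ρ v * wd ρ u) y y else 0) =
      ∑ x, if par y = flipn u.length p then wd ρ v y x * wd ρ u x y else 0 := by
    intro x; split_ifs
    · rw [Matrix.mul_apply]
    · simp
  simp only [e1, e2]
  rw [Finset.sum_comm]
  refine Finset.sum_congr rfl fun y _ => Finset.sum_congr rfl fun x _ => ?_
  by_cases h : wd ρ u x y = 0
  · simp [h]
  · have h1 := wd_par _ _ _ _ h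
    have : par x = p ↔ par y = flipn u.length p := by
      constructor
      · rintro rfl; exact h1
      · intro h2; rw [← flipn_flipn u.length (par x), ← h1, h2, flipn_flipn]
    rw [if_congr this (mul_comm _ _) rfl]

theorem Q_rot1 (u v : GDiagram) (h : Q (v ++ u)) : Q (u ++ v) := by
  intro p ρ
  rw [← h (flipn u.length p) ρ]
  unfold Z
  rw [SS_perm (heads_perm (List.perm_append_comm (l₁ := u) (l₂ := v)))]
  have e : (fun ρ => trp p (wd ρ (u ++ v))) =
      fun ρ => trp (flipn u.length p) (wd ρ (v ++ u)) := by
    funext ρ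
    exact trp_rot ρ u v p
  rw [e]

theorem Q_rot (u v : GDiagram) : Q (u ++ v) ↔ Q (v ++ u) := ⟨Q_rot1 _ _, Q_rot1 _ _⟩

theorem Z_relabel (f : ℕ → ℕ) (hf : Function.Injective f) (p : Bool) (D : GDiagram) (ρ : ℕ → Kap) :
    Z p (relabel f D) ρ = Z p D (ρ ∘ f) := by
  have h1 : heads (relabel f D) = (heads D).map f := by
    unfold heads relabel
    rw [List.filter_map, List.map_map, List.map_map]
    rfl
  have h2 : ∀ ρ, wd ρ (relabel f D) = wd (ρ ∘ f) D := by
    intro ρ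
    unfold wd relabel
    rw [List.map_map]
    rfl
  have h3 : ∀ (L : List ℕ) (G : (ℕ → Kap) → ZMod 2) ρ,
      SS (L.map f) (fun ρ => G (ρ ∘ f)) ρ = SS L G (ρ ∘ f) := by
    intro L G
    induction L with
    | nil => intro ρ; rfl
    | cons a L ih =>
      intro ρ
      rw [List.map_cons, SS_cons, SS_cons]
      refine Finset.sum_congr rfl fun κ _ => ?_
      rw [ih, Function.update_comp_eq_of_injective _ hf]
  unfold Z
  rw [h1]
  simp only [h2]
  exact h3 _ (fun ρ => trp p (wd ρ D)) ρ

theorem Q_relabel (f : ℕ → ℕ) (hf : Function.Injective f) (D : GDiagram) :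
    Q (relabel f D) ↔ Q D := by
  constructor
  · intro h p ρ
    have := h p (ρ ∘ Function.invFun f)
    rw [Z_relabel f hf] at this
    rw [← this]
    congr 1
    funext a
    simp [Function.leftInverse_invFun hf a]
  · intro h p ρ
    rw [Z_relabel f hf]
    exact h _ _

theorem Q_same {D D' : GDiagram} (h : Same D D') : Q D ↔ Q D' := by
  obtain ⟨f, u, v, hf, rfl, rfl⟩ := h
  rw [Q_relabel f hf, Q_rot]

theorem gauss_perm {D D' : GDiagram} (h : D.Perm D') : IsGauss D ↔ IsGauss D' := by
  unfold IsGauss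
  simp only [h.count_eq]

theorem gauss_relabel (f : ℕ → ℕ) (hf : Function.Injective f) (D : GDiagram) :
    IsGauss (relabel f D) ↔ IsGauss D := by
  have hc : ∀ a s, List.count (f a, s) (relabel f D) = List.count (a, s) D := by
    intro a s
    have hg : Function.Injective (fun e : Endpoint => ((f e.1, e.2) : Endpoint)) := by
      rintro ⟨a, s⟩ ⟨b, t⟩ h
      simp only [Prod.mk.injEq] at h
      rw [hf h.1, h.2]
    exact List.count_map_of_injective D _ hg (a, s)
  constructor
  · intro h a
    have := h (f a)
    rwa [hc, hc] at this
  · intro h b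
    by_cases hb : ∃ a, f a = b
    · obtain ⟨a, rfl⟩ := hb
      rw [hc, hc]; exact h a
    · left
      constructor <;>
      · rw [List.count_eq_zero]
        intro hm
        obtain ⟨e, -, he⟩ := List.mem_map.1 hm
        exact hb ⟨e.1, congrArg Prod.fst he⟩

theorem gauss_same {D D' : GDiagram} (h : Same D D') : IsGauss D ↔ IsGauss D' := by
  obtain ⟨f, u, v, hf, rfl, rfl⟩ := h
  rw [gauss_relabel f hf, gauss_perm List.perm_append_comm]

theorem gauss_out {D E : GDiagram} (h : IsGauss D) (a : ℕ) (s : Bool)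
    (hp : D.Perm ((a, s) :: (a, !s) :: E)) : ∀ e ∈ E, e.1 ≠ a := by
  rintro ⟨b, t⟩ he rfl
  have h1 := (gauss_perm hp).1 h b
  have h2 : 0 < List.count (b, t) E := List.count_pos_iff.2 he
  rw [List.count_cons, List.count_cons, List.count_cons, List.count_cons] at h1
  cases s <;> cases t <;> simp at h1 <;> omega

theorem ten1 : ∀ s, ∑ κ, (Matrix.of (M κ s) : Mat) * Matrix.of (M κ (!s)) = 1 := by
  intro s
  ext x z
  rw [Matrix.sum_apply]
  simp only [Matrix.mul_apply, Matrix.of_apply]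
  rw [Finset.sum_comm]
  simp only [sumM]
  rw [good.kink, Matrix.one_apply]

theorem Q_fr1 {D D' : GDiagram} (hg : IsGauss D) (h : fr1 D D') : Q D ↔ Q D' := by
  obtain ⟨a, s, u, v, rfl, rfl⟩ := h
  have hp : (u ++ [(a, s), (a, !s)] ++ v).Perm ((a, s) :: (a, !s) :: (u ++ v)) := by
    rw [List.append_assoc]
    refine (List.perm_append_comm_assoc _ _ _).trans ?_
    rfl
  have ho := gauss_out hg a s hp
  have hu : ∀ e ∈ u, e.1 ≠ a := fun e he => ho e (by simp [he])
  have hv : ∀ e ∈ v, e.1 ≠ a := fun e he => ho e (by simp [he])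
  refine Q_local (H := heads (u ++ v)) (C := [a]) (C' := []) ?_ (by simp) ?_
  · refine (heads_perm hp).trans ?_
    rw [heads_pair]
    exact (List.perm_append_singleton _ _).symm
  · intro ρ
    rw [SS_cons, SS_nil, SS_nil]
    have e : ∀ κ, wd (Function.update ρ a κ) (u ++ [(a, s), (a, !s)] ++ v) =
        wd ρ u * ((Matrix.of (M κ s) : Mat) * Matrix.of (M κ (!s))) * wd ρ v := by
      intro κ
      rw [wd_append, wd_append, wd_update _ _ _ _ hu, wd_update _ _ _ _ hv, wd_cons, wd_cons, wd_nil]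
      simp [letter]
    simp only [e]
    rw [← Finset.sum_mul, ← Finset.mul_sum, ten1, mul_one, wd_append]

section contraction
variable {K Y : Type} [Fintype K] [Fintype Y]

theorem prod2 (f g : K → ZMod 2) :
    (∑ i, f i) * (∑ j, g j) = ∑ i, ∑ j, f i * g j := Finset.sum_mul_sum _ _ _ _

theorem prod3 (f g h : K → ZMod 2) :
    (∑ i, f i) * (∑ j, g j) * (∑ k, h k) = ∑ i, ∑ j, ∑ k, f i * g j * h k := by
  rw [Finset.sum_mul_sum, Finset.sum_mul]
  refine Finset.sum_congr rfl fun i _ => ?_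
  rw [Finset.sum_mul]
  refine Finset.sum_congr rfl fun j _ => ?_
  rw [Finset.mul_sum]

theorem pk2 (g : K → K → ZMod 2) : ∑ a, ∑ b, g a b = ∑ q : K × K, g q.1 q.2 := by
  rw [Fintype.sum_prod_type]

theorem pk3 (g : K → K → K → ZMod 2) :
    ∑ a, ∑ b, ∑ c, g a b c = ∑ q : K × K × K, g q.1 q.2.1 q.2.2 := by
  rw [Fintype.sum_prod_type]
  refine Finset.sum_congr rfl fun i _ => ?_
  rw [Fintype.sum_prod_type]

theorem contr2 (a b c d : K → Y → ZMod 2) :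
    ∑ κ, ∑ μ, (∑ m, a κ m * b μ m) * (∑ n, c κ n * d μ n) =
      ∑ m, ∑ n, (∑ κ, a κ m * c κ n) * (∑ μ, b μ m * d μ n) := by
  simp only [prod2]
  rw [pk2, pk2]
  simp only [pk2]
  rw [Finset.sum_comm]
  refine Finset.sum_congr rfl fun q _ => Finset.sum_congr rfl fun r _ => ?_
  ring

theorem contr3 (a b c d e f : K → Y → ZMod 2) :
    ∑ κ, ∑ l, ∑ μ, (∑ u, a κ u * b l u) * (∑ v, c κ v * d μ v) * (∑ w, e l w * f μ w) =
      ∑ u, ∑ v, ∑ w, (∑ κ, a κ u * c κ v) * (∑ l, b l u * e l w) * (∑ μ, d μ v * f μ w) := by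
  simp only [prod3]
  rw [pk3, pk3]
  simp only [pk3]
  rw [Finset.sum_comm]
  refine Finset.sum_congr rfl fun q _ => Finset.sum_congr rfl fun r _ => ?_
  ring

end contraction

section tens
variable {I Y : Type} [Fintype I] [Fintype Y]

theorem ten2 [DecidableEq Y] (A B : I → Matrix Y Y (ZMod 2)) (U V W : Matrix Y Y (ZMod 2))
    (h : ∀ i j k l, ∑ t, A t i j * B t k l = if i = j ∧ k = l then 1 else 0) :
    ∑ t, U * A t * V * B t * W = U * V * W := by
  have e : ∑ t, A t * V * B t = V := by
    ext i l
    rw [Matrix.sum_apply]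
    have : ∀ t, (A t * V * B t) i l = ∑ k, ∑ j, V j k * (A t i j * B t k l) := by
      intro t
      rw [Matrix.mul_apply]
      refine Finset.sum_congr rfl fun k _ => ?_
      rw [Matrix.mul_apply, Finset.sum_mul]
      refine Finset.sum_congr rfl fun j _ => ?_
      ring
    simp only [this]
    rw [Finset.sum_comm, Finset.sum_eq_single l]
    · rw [Finset.sum_comm, Finset.sum_eq_single i]
      · rw [← Finset.mul_sum, h]; simp
      · intro j _ hj
        rw [← Finset.mul_sum, h]; simp [Ne.symm hj]
      · simp
    · intro k _ hk
      rw [Finset.sum_comm]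
      refine Finset.sum_eq_zero fun j _ => ?_
      rw [← Finset.mul_sum, h]; simp [hk]
    · simp
  have e2 : ∀ t, U * A t * V * B t * W = U * (A t * V * B t) * W := by
    intro t; simp only [mul_assoc]
  simp only [e2]
  rw [← Finset.sum_mul, ← Finset.mul_sum, e]

theorem ten3_expand (A B C : I → Matrix Y Y (ZMod 2)) (V W : Matrix Y Y (ZMod 2)) (i n : Y) :
    (∑ t, A t * V * B t * W * C t) i n =
      ∑ m, ∑ l, ∑ k, ∑ j, V j k * W l m * ∑ t, A t i j * B t k l * C t m n := by
  have e : ∀ t, (A t * V * B t * W * C t) i n =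
      ∑ m, ∑ l, ∑ k, ∑ j, V j k * W l m * (A t i j * B t k l * C t m n) := by
    intro t
    rw [Matrix.mul_apply]
    refine Finset.sum_congr rfl fun m _ => ?_
    rw [Matrix.mul_apply, Finset.sum_mul]
    refine Finset.sum_congr rfl fun l _ => ?_
    rw [Matrix.mul_apply, Finset.sum_mul, Finset.sum_mul]
    refine Finset.sum_congr rfl fun k _ => ?_
    rw [Matrix.mul_apply, Finset.sum_mul, Finset.sum_mul, Finset.sum_mul]
    refine Finset.sum_congr rfl fun j _ => ?_
    ring
  rw [Matrix.sum_apply]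
  simp only [e]
  rw [Finset.sum_comm]
  refine Finset.sum_congr rfl fun m _ => ?_
  rw [Finset.sum_comm]
  refine Finset.sum_congr rfl fun l _ => ?_
  rw [Finset.sum_comm]
  refine Finset.sum_congr rfl fun k _ => ?_
  rw [Finset.sum_comm]
  refine Finset.sum_congr rfl fun j _ => ?_
  rw [Finset.mul_sum]

theorem ten3 (A B C A' B' C' : I → Matrix Y Y (ZMod 2)) (U V W T : Matrix Y Y (ZMod 2))
    (h : ∀ i j k l m n, ∑ t, A t i j * B t k l * C t m n = ∑ t, A' t i j * B' t k l * C' t m n) :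
    ∑ t, U * A t * V * B t * W * C t * T = ∑ t, U * A' t * V * B' t * W * C' t * T := by
  have e : ∑ t, A t * V * B t * W * C t = ∑ t, A' t * V * B' t * W * C' t := by
    ext i n
    rw [ten3_expand, ten3_expand]
    simp only [h]
  have e2 : ∀ A B C : Matrix Y Y (ZMod 2), U * A * V * B * W * C * T =
      U * (A * V * B * W * C) * T := by
    intro A B C; simp only [mul_assoc]
  simp only [e2]
  rw [← Finset.sum_mul, ← Finset.mul_sum, e, Finset.mul_sum, Finset.sum_mul]

end tens

def lm (κ : Kap) (s : Bool) : Mat := Matrix.of (M κ s)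

theorem sumL (s : Bool) (x x' y y' : X) : ∑ κ, lm κ s x x' * lm κ (!s) y y' = R x x' y y' :=
  sumM s x x' y y'

theorem fr2a (i j k l : X) : ∑ t : Kap × Kap, (lm t.1 true * lm t.2 true) i j *
    (lm t.1 false * lm t.2 false) k l = if i = j ∧ k = l then 1 else 0 := by
  rw [Fintype.sum_prod_type]
  simp only [Matrix.mul_apply]
  rw [contr2 (fun κ m => lm κ true i m) (fun κ m => lm κ true m j) (fun κ m => lm κ false k m)
    (fun κ m => lm κ false m l), ← good.two]
  refine Finset.sum_congr rfl fun m _ => Finset.sum_congr rfl fun n _ => ?_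
  rw [← sumL true, ← sumL true]; rfl

theorem fr2b (i j k l : X) : ∑ t : Kap × Kap, (lm t.1 true * lm t.2 true) i j *
    (lm t.2 false * lm t.1 false) k l = if i = j ∧ k = l then 1 else 0 := by
  rw [Fintype.sum_prod_type]
  simp only [Matrix.mul_apply]
  have e : ∀ κ μ : Kap, (∑ m, lm κ true i m * lm μ true m j) * (∑ n, lm μ false k n * lm κ false n l) =
      (∑ m, lm κ true i m * lm μ true m j) * (∑ n, lm κ false n l * lm μ false k n) := by
    intro κ μ
    rw [Finset.sum_congr rfl fun n _ => mul_comm (lm μ false k n) (lm κ false n l)]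
  simp only [e]
  rw [contr2 (fun κ m => lm κ true i m) (fun κ m => lm κ true m j) (fun κ m => lm κ false m l)
    (fun κ m => lm κ false k m), ← good.two']
  refine Finset.sum_congr rfl fun m _ => Finset.sum_congr rfl fun n _ => ?_
  rw [← sumL true, ← sumL true]; rfl

theorem heads_to (D : GDiagram) {F E : GDiagram} {C : List ℕ} (h : D.Perm (F ++ E))
    (hF : heads F = C) : (heads D).Perm (heads E ++ C) := by
  refine (heads_perm h).trans ?_
  rw [heads_append, hF]
  exact List.perm_append_comm

theorem Q_fr2 {D D' : GDiagram} (hg : IsGauss D) (h : fr2 D D') : Q D ↔ Q D' := by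
  obtain ⟨a, b, x, y, z, t, u, v, w, hab, hxy, hzt, rfl, rfl⟩ := h
  have hne : x ≠ y := by
    rintro rfl
    have ha : a ∈ ({x, x} : Set ℕ) := by rw [hxy]; simp
    have hb : b ∈ ({x, x} : Set ℕ) := by rw [hxy]; simp
    simp at ha hb
    exact hab (ha.trans hb.symm)
  have hc : (z = x ∧ t = y) ∨ (z = y ∧ t = x) := by
    rw [← hxy] at hzt
    have h1 : z ∈ ({x, y} : Set ℕ) := by rw [← hzt]; simp
    have h2 : t ∈ ({x, y} : Set ℕ) := by rw [← hzt]; simp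
    have h3 : x ∈ ({z, t} : Set ℕ) := by rw [hzt]; simp
    have h4 : y ∈ ({z, t} : Set ℕ) := by rw [hzt]; simp
    simp at h1 h2 h3 h4
    omega
  set D := u ++ [(x, true), (y, true)] ++ v ++ [(z, false), (t, false)] ++ w with hD
  have hp1 : D.Perm ((x, true) :: (x, !true) :: (y, true) :: (y, !true) :: (u ++ v ++ w)) := by
    rw [List.perm_iff_count]
    intro e
    rw [hD]
    rcases hc with ⟨rfl, rfl⟩ | ⟨rfl, rfl⟩ <;>
    · simp only [List.count_append, List.count_cons, List.count_nil, Bool.not_true]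
      ring
  have hp2 : D.Perm ((y, true) :: (y, !true) :: (x, true) :: (x, !true) :: (u ++ v ++ w)) := by
    refine hp1.trans ?_
    rw [List.perm_iff_count]
    intro e
    simp only [List.count_append, List.count_cons]
    ring
  have ox := gauss_out hg x true hp1
  have oy := gauss_out hg y true hp2
  have hW : ∀ f : GDiagram, (∀ e ∈ f, e ∈ u ++ v ++ w) → ∀ ρ κ μ,
      wd (Function.update (Function.update ρ x κ) y μ) f = wd ρ f := by
    intro f hf ρ κ μ
    rw [wd_update, wd_update]
    · intro e he; exact ox e (by simp only [List.mem_cons]; exact Or.inr (Or.inr (hf e he)))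
    · intro e he; exact oy e (by simp only [List.mem_cons]; exact Or.inr (Or.inr (hf e he)))
  have hu := hW u (fun e he => by simp [he])
  have hv := hW v (fun e he => by simp [he])
  have hw := hW w (fun e he => by simp [he])
  refine Q_local (H := heads (u ++ v ++ w)) (C := [x, y]) (C' := []) ?_ (by simp) ?_
  · refine heads_to D (F := [(x, true), (x, !true), (y, true), (y, !true)]) hp1 (by simp [heads])
  · intro ρ
    rw [SS_cons]
    simp only [SS_cons, SS_nil]
    rw [← Fintype.sum_prod_type' (fun κ μ => wd (Function.update (Function.update ρ x κ) y μ) D)]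
    rw [wd_append, wd_append]
    have lx : ∀ κ μ s, letter (Function.update (Function.update ρ x κ) y μ) (x, s) = lm κ s := by
      intro κ μ s; simp [letter, lm, hne]
    have ly : ∀ κ μ s, letter (Function.update (Function.update ρ x κ) y μ) (y, s) = lm μ s := by
      intro κ μ s; simp [letter, lm]
    rcases hc with ⟨rfl, rfl⟩ | ⟨rfl, rfl⟩
    · rw [← ten2 (fun t : Kap × Kap => lm t.1 true * lm t.2 true)
        (fun t : Kap × Kap => lm t.1 false * lm t.2 false) _ _ _ fr2a]
      refine Finset.sum_congr rfl fun q _ => ?_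
      simp only [hD, wd_append, hu, hv, hw, wd_cons, wd_nil, lx, ly, mul_one]
    · rw [← ten2 (fun t : Kap × Kap => lm t.1 true * lm t.2 true)
        (fun t : Kap × Kap => lm t.2 false * lm t.1 false) _ _ _ fr2b]
      refine Finset.sum_congr rfl fun q _ => ?_
      simp only [hD, wd_append, hu, hv, hw, wd_cons, wd_nil, lx, ly, mul_one]

def str (o : Bool) (A B : Mat) : Mat := if o then A * B else B * A

theorem str_apply (o : Bool) (A B : Mat) (x x' : X) : str o A B x x' =
    ∑ u, A (prt o x x' u).1 (prt o x x' u).2 * B (prt (!o) x x' u).1 (prt (!o) x x' u).2 := by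
  cases o
  · simp only [str, prt, Bool.false_eq_true, if_false, Matrix.mul_apply, Bool.not_false, if_true]
    exact Finset.sum_congr rfl fun n _ => mul_comm _ _
  · simp only [str, prt, Bool.false_eq_true, if_false, Matrix.mul_apply, Bool.not_true, if_true]

theorem core3 (o1 o2 o3 sp sq sr : Bool) (x1 x1' x2 x2' x3 x3' : X) :
    ∑ t : Kap × Kap × Kap, str o1 (lm t.1 sp) (lm t.2.1 sq) x1 x1' *
      str o2 (lm t.1 (!sp)) (lm t.2.2 sr) x2 x2' *
      str o3 (lm t.2.1 (!sq)) (lm t.2.2 (!sr)) x3 x3' = Tri R o1 o2 o3 x1 x1' x2 x2' x3 x3' := by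
  rw [← pk3 (fun κ l μ => str o1 (lm κ sp) (lm l sq) x1 x1' *
      str o2 (lm κ (!sp)) (lm μ sr) x2 x2' *
      str o3 (lm l (!sq)) (lm μ (!sr)) x3 x3')]
  simp only [str_apply]
  rw [contr3 (fun κ u => lm κ sp (prt o1 x1 x1' u).1 (prt o1 x1 x1' u).2)
    (fun κ u => lm κ sq (prt (!o1) x1 x1' u).1 (prt (!o1) x1 x1' u).2)
    (fun κ u => lm κ (!sp) (prt o2 x2 x2' u).1 (prt o2 x2 x2' u).2)
    (fun κ u => lm κ sr (prt (!o2) x2 x2' u).1 (prt (!o2) x2 x2' u).2)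
    (fun κ u => lm κ (!sq) (prt o3 x3 x3' u).1 (prt o3 x3 x3' u).2)
    (fun κ u => lm κ (!sr) (prt (!o3) x3 x3' u).1 (prt (!o3) x3 x3' u).2)]
  simp only [sumL]
  unfold Tri Rr
  exact Eq.refl _

def Wo (o : Bool) (e f : Endpoint) : GDiagram := if o then [e, f] else [f, e]

theorem wd_Wo (ρ : ℕ → Kap) (o : Bool) (e f : Endpoint) :
    wd ρ (Wo o e f) = str o (letter ρ e) (letter ρ f) := by
  cases o <;> simp [Wo, str, wd]

theorem Wo_count (o : Bool) (e f g : Endpoint) :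
    List.count g (Wo o e f) = List.count g [e] + List.count g [f] := by
  cases o <;> simp [Wo, List.count_cons]
  ring

def D3 (o1 o2 o3 sp sq sr : Bool) (p q r : ℕ) (u v w x : GDiagram) : GDiagram :=
  u ++ Wo o1 (p, sp) (q, sq) ++ v ++ Wo o2 (p, !sp) (r, sr) ++ w ++ Wo o3 (q, !sq) (r, !sr) ++ x

theorem D3_perm (o1 o2 o3 sp sq sr : Bool) (p q r : ℕ) (u v w x : GDiagram) :
    (D3 o1 o2 o3 sp sq sr p q r u v w x).Perm
      ((p, sp) :: (p, !sp) :: (q, sq) :: (q, !sq) :: (r, sr) :: (r, !sr) :: (u ++ v ++ w ++ x)) := by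
  rw [List.perm_iff_count]
  intro e
  unfold D3
  simp only [List.count_append, Wo_count, List.count_cons, List.count_nil]
  ring

theorem Q_D3 (o1 o2 o3 sp sq sr : Bool) (p q r : ℕ) (u v w x : GDiagram)
    (hpq : p ≠ q) (hpr : p ≠ r) (hqr : q ≠ r)
    (hg : IsGauss (D3 o1 o2 o3 sp sq sr p q r u v w x)) :
    Q (D3 o1 o2 o3 sp sq sr p q r u v w x) ↔ Q (D3 (!o1) (!o2) (!o3) sp sq sr p q r u v w x) := by
  have hp1 := D3_perm o1 o2 o3 sp sq sr p q r u v w x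
  have hp2 := D3_perm (!o1) (!o2) (!o3) sp sq sr p q r u v w x
  have op := gauss_out hg p sp hp1
  have oq := gauss_out hg q sq (E := (p, sp) :: (p, !sp) :: (r, sr) :: (r, !sr) :: (u ++ v ++ w ++ x))
    (hp1.trans (by
      rw [List.perm_iff_count]; intro e; simp only [List.count_cons]; ring))
  have or := gauss_out hg r sr (E := (p, sp) :: (p, !sp) :: (q, sq) :: (q, !sq) :: (u ++ v ++ w ++ x))
    (hp1.trans (by
      rw [List.perm_iff_count]; intro e; simp only [List.count_cons]; ring))
  have hW : ∀ f : GDiagram, (∀ e ∈ f, e ∈ u ++ v ++ w ++ x) → ∀ ρ κ l μ,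
      wd (Function.update (Function.update (Function.update ρ p κ) q l) r μ) f = wd ρ f := by
    intro f hf ρ κ l μ
    rw [wd_update, wd_update, wd_update]
    · intro e he; refine op e ?_; simp only [List.mem_cons]; simp only [hf e he, or_true]
    · intro e he; refine oq e ?_; simp only [List.mem_cons]; simp only [hf e he, or_true]
    · intro e he; refine or e ?_; simp only [List.mem_cons]; simp only [hf e he, or_true]
  have hu := hW u (fun e he => by simp [he])
  have hv := hW v (fun e he => by simp [he])
  have hw := hW w (fun e he => by simp [he])
  have hx := hW x (fun e he => by simp [he])
  have hh : heads [(p, sp), (p, !sp), (q, sq), (q, !sq), (r, sr), (r, !sr)] = [p, q, r] := by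
    rw [heads_pair, heads_pair, heads_pair]; rfl
  refine Q_local (H := heads (u ++ v ++ w ++ x)) (C := [p, q, r]) (C' := [p, q, r])
    (heads_to _ hp1 hh) (heads_to _ hp2 hh) ?_
  intro ρ
  have key : ∀ o1 o2 o3, SS [p, q, r] (fun ρ => wd ρ (D3 o1 o2 o3 sp sq sr p q r u v w x)) ρ =
      ∑ t : Kap × Kap × Kap, wd ρ u * str o1 (lm t.1 sp) (lm t.2.1 sq) * wd ρ v *
        str o2 (lm t.1 (!sp)) (lm t.2.2 sr) * wd ρ w *
        str o3 (lm t.2.1 (!sq)) (lm t.2.2 (!sr)) * wd ρ x := by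
    intro o1 o2 o3
    rw [SS_cons]
    simp only [SS_cons, SS_nil]
    rw [Fintype.sum_prod_type]
    refine Finset.sum_congr rfl fun κ _ => ?_
    rw [Fintype.sum_prod_type]
    refine Finset.sum_congr rfl fun l _ => Finset.sum_congr rfl fun μ _ => ?_
    have lp : ∀ s, letter (Function.update (Function.update (Function.update ρ p κ) q l) r μ) (p, s)
        = lm κ s := by
      intro s; simp [letter, lm, hpq, hpr]
    have lq : ∀ s, letter (Function.update (Function.update (Function.update ρ p κ) q l) r μ) (q, s)
        = lm l s := by
      intro s; simp [letter, lm, hqr]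
    have lr : ∀ s, letter (Function.update (Function.update (Function.update ρ p κ) q l) r μ) (r, s)
        = lm μ s := by
      intro s; simp [letter, lm]
    simp only [D3, wd_append, wd_Wo, lp, lq, lr, hu, hv, hw, hx]
  rw [key, key]
  refine ten3 _ _ _ _ _ _ _ _ _ _ ?_
  intro i j k l m n
  rw [core3, core3]
  exact good.tri _ _ _ _ _ _ _ _ _

def opp (e : Endpoint) : Endpoint := (e.1, !e.2)

theorem opp_opp (e : Endpoint) : opp (opp e) = e := by simp [opp]

theorem fr3_form {D D' : GDiagram} (h : fr3 D D') :
    ∃ (o1 o2 o3 sp sq sr : Bool) (p q r : ℕ) (u v w x : GDiagram), p ≠ q ∧ p ≠ r ∧ q ≠ r ∧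
      D = D3 o1 o2 o3 sp sq sr p q r u v w x ∧
      D' = D3 (!o1) (!o2) (!o3) sp sq sr p q r u v w x := by
  obtain ⟨a, b, c, e1, e2, e3, e4, e5, e6, u, v, w, x, hab, hbc, hac, h12, h34, h56, hm, rfl, rfl⟩ := h
  have hperm : [e1, e2, e3, e4, e5, e6].Perm
      [(a, true), (a, false), (b, true), (b, false), (c, true), (c, false)] :=
    Multiset.coe_eq_coe.1 hm
  have hnd : [e1, e2, e3, e4, e5, e6].Nodup := by
    rw [hperm.nodup_iff]
    simp [hab, hbc, hac]
  have hopp : ∀ e ∈ [e1, e2, e3, e4, e5, e6], opp e ∈ [e1, e2, e3, e4, e5, e6] := by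
    intro e
    rw [hperm.mem_iff, hperm.mem_iff]
    obtain ⟨l, s⟩ := e
    cases s <;> simp [opp]
  have hno : ∀ e f : Endpoint, e.1 ≠ f.1 → opp e ≠ f := by
    rintro e f h rfl; exact h rfl
  have hself : ∀ e, opp e ≠ e := by
    rintro ⟨l, s⟩; cases s <;> simp [opp]
  have hinj : ∀ e f, opp e = f → opp f = e := by rintro e f rfl; exact opp_opp e
  have main : ∃ (o1 o2 o3 : Bool) (p q r : Endpoint), p.1 ≠ q.1 ∧ p.1 ≠ r.1 ∧ q.1 ≠ r.1 ∧
      [e1, e2] = Wo o1 p q ∧ [e3, e4] = Wo o2 (opp p) r ∧ [e5, e6] = Wo o3 (opp q) (opp r) := by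
    have m1 := hopp e1 (by simp)
    have m2 := hopp e2 (by simp)
    have m3 := hopp e3 (by simp)
    have m4 := hopp e4 (by simp)
    have m5 := hopp e5 (by simp)
    simp only [List.mem_cons, List.not_mem_nil, or_false, hself, hno _ _ h12, hno _ _ h12.symm,
      hno _ _ h34, hno _ _ h34.symm, hno _ _ h56, false_or] at m1 m2 m3 m4 m5
    simp only [List.nodup_cons, List.mem_cons, List.not_mem_nil, or_false, not_or] at hnd
    clear hopp hno hself hperm hm
    have fin : ∀ (o1 o2 o3 : Bool) (p q r : Endpoint), 
      [e1, e2] = Wo o1 p q → [e3, e4] = Wo o2 (opp p) r → [e5, e6] = Wo o3 (opp q) (opp r) →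
      ∃ (o1 o2 o3 : Bool) (p q r : Endpoint), p.1 ≠ q.1 ∧ p.1 ≠ r.1 ∧ q.1 ≠ r.1 ∧
      [e1, e2] = Wo o1 p q ∧ [e3, e4] = Wo o2 (opp p) r ∧ [e5, e6] = Wo o3 (opp q) (opp r) := by
      intro o1 o2 o3 p q r w1 w2 w3
      refine ⟨o1, o2, o3, p, q, r, ?_, ?_, ?_, w1, w2, w3⟩
      · cases o1 <;> simp [Wo] at w1 <;> obtain ⟨rfl, rfl⟩ := w1
        · exact h12.symm
        · exact h12
      · cases o2 <;> simp [Wo] at w2 <;> obtain ⟨rfl, rfl⟩ := w2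
        · exact h34.symm
        · exact h34
      · cases o3 <;> simp [Wo] at w3 <;> obtain ⟨rfl, rfl⟩ := w3
        · exact h56.symm
        · exact h56
    rcases m1 with h1 | h1 | h1 | h1 <;> rcases m2 with h2 | h2 | h2 | h2
    · exfalso; grind
    · exfalso; grind
    · have hr : opp e4 = e6 := by grind
      exact fin true true true e1 e2 e4 rfl (by rw [h1]; rfl) (by rw [h2, hr]; rfl)
    · have hr : opp e4 = e5 := by grind
      exact fin true true false e1 e2 e4 rfl (by rw [h1]; rfl) (by rw [h2, hr]; rfl)
    · exfalso; grind
    · exfalso; grind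
    · have hr : opp e3 = e6 := by grind
      exact fin true false true e1 e2 e3 rfl (by rw [h1]; rfl) (by rw [h2, hr]; rfl)
    · have hr : opp e3 = e5 := by grind
      exact fin true false false e1 e2 e3 rfl (by rw [h1]; rfl) (by rw [h2, hr]; rfl)
    · have hr : opp e4 = e6 := by grind
      exact fin false true true e2 e1 e4 rfl (by rw [h2]; rfl) (by rw [h1, hr]; rfl)
    · have hr : opp e3 = e6 := by grind
      exact fin false false true e2 e1 e3 rfl (by rw [h2]; rfl) (by rw [h1, hr]; rfl)
    · exfalso; grind
    · exfalso; grind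
    · have hr : opp e4 = e5 := by grind
      exact fin false true false e2 e1 e4 rfl (by rw [h2]; rfl) (by rw [h1, hr]; rfl)
    · have hr : opp e3 = e5 := by grind
      exact fin false false false e2 e1 e3 rfl (by rw [h2]; rfl) (by rw [h1, hr]; rfl)
    · exfalso; grind
    · exfalso; grind
  obtain ⟨o1, o2, o3, ⟨p, sp⟩, ⟨q, sq⟩, ⟨r, sr⟩, hpq, hpr, hqr, w1, w2, w3⟩ := main
  have hflip : ∀ (o : Bool) (e f g h : Endpoint), [e, f] = Wo o g h → [f, e] = Wo (!o) g h := by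
    intro o e f g h hh
    cases o <;> simp [Wo] at hh ⊢ <;> tauto
  refine ⟨o1, o2, o3, sp, sq, sr, p, q, r, u, v, w, x, hpq, hpr, hqr, ?_, ?_⟩
  · rw [w1, w2, w3]; rfl
  · rw [hflip _ _ _ _ _ w1, hflip _ _ _ _ _ w2, hflip _ _ _ _ _ w3]; rfl

theorem Q_fr3 {D D' : GDiagram} (hg : IsGauss D) (h : fr3 D D') : Q D ↔ Q D' := by
  obtain ⟨o1, o2, o3, sp, sq, sr, p, q, r, u, v, w, x, hpq, hpr, hqr, rfl, rfl⟩ := fr3_form h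
  exact Q_D3 _ _ _ _ _ _ _ _ _ _ _ _ _ hpq hpr hqr hg

theorem Q_move {D D' : GDiagram} (h : Move D D') : Q D ↔ Q D' := by
  obtain ⟨hg, hg', h⟩ := h
  rcases h with ⟨E, E', h1, h2, h3⟩ | ⟨E, E', h1, h2, h3⟩ | ⟨E, E', h1, h2, h3⟩ |
    ⟨E, E', h1, h2, h3⟩ | ⟨E, E', h1, h2, h3⟩ | h
  · rw [Q_same h1, Q_fr1 ((gauss_same h1).1 hg) h2, Q_same h3]
  · rw [Q_same h1, ← Q_fr1 ((gauss_same h3).2 hg') h2, Q_same h3]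
  · rw [Q_same h1, Q_fr2 ((gauss_same h1).1 hg) h2, Q_same h3]
  · rw [Q_same h1, ← Q_fr2 ((gauss_same h3).2 hg') h2, Q_same h3]
  · rw [Q_same h1, Q_fr3 ((gauss_same h1).1 hg) h2, Q_same h3]
  · exact Q_same h

theorem Q_flat {D D' : GDiagram} (h : FlatEq D D') : Q D ↔ Q D' := by
  induction h with
  | rel _ _ h => exact Q_move h
  | refl _ => exact Iff.rfl
  | symm _ _ _ ih => exact ih.symm
  | trans _ _ _ _ _ ih1 ih2 => exact ih1.trans ih2

def req : Kap → Bool → Bool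
  | .inl (p, _), _ => p
  | .inr (_, u, _), s => xor (par u) s

theorem ind_ne {q : Prop} [Decidable q] (h : ind q ≠ 0) : q := by
  by_contra hc; exact h (if_neg hc)

theorem M_req (κ : Kap) (s : Bool) (x z : X) (h : M κ s x z ≠ 0) : req κ s = par x := by
  rcases κ with ⟨p, _ | i⟩ | ⟨_ | _, u, v⟩
  · exact (ind_ne h).1.symm
  · exact (ind_ne h).1.symm
  · obtain ⟨h1, h2⟩ := ind_ne h
    cases s
    · simp at h2; simp [req, h2.1]
    · simp at h2; simp [req, h2.1, h1]
  · obtain ⟨h1, h2⟩ := ind_ne h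
    cases s
    · simp at h2; simp [req, h2.1]
    · simp at h2; simp [req, h2.1, par_st]

def reqOK (ρ : ℕ → Kap) : GDiagram → Bool → Prop
  | [], _ => True
  | e :: D, p => req (ρ e.1) e.2 = p ∧ reqOK ρ D (!p)

theorem wd_req (ρ : ℕ → Kap) (D : GDiagram) (x y : X) (h : wd ρ D x y ≠ 0) :
    reqOK ρ D (par x) := by
  induction D generalizing x with
  | nil => trivial
  | cons e D ih =>
    rw [wd_cons, Matrix.mul_apply] at h
    obtain ⟨z, -, hz⟩ := Finset.exists_ne_zero_of_sum_ne_zero h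
    have h0 := left_ne_zero_of_mul hz
    refine ⟨M_req _ _ _ _ h0, ?_⟩
    have h2 := ih z (right_ne_zero_of_mul hz)
    rwa [M_par _ _ _ _ h0] at h2

theorem req_both (κ : Kap) (c : Bool) (h1 : req κ false = c) (h2 : req κ true = c) :
    ∃ o, κ = .inl (c, o) := by
  rcases κ with ⟨p, o⟩ | ⟨b, u, v⟩
  · exact ⟨o, by rw [← h1]; rfl⟩
  · exfalso
    rw [← h1] at h2
    simp [req] at h2

abbrev Gm := ℕ → Option (Fin 24)

def SG (L : List ℕ) (G : Gm → ZMod 2) : Gm → ZMod 2 :=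
  L.foldr (fun a G g => ∑ o, G (Function.update g a o)) G

theorem SG_nil (G : Gm → ZMod 2) : SG [] G = G := rfl

theorem SG_cons (a : ℕ) (L : List ℕ) (G : Gm → ZMod 2) (g : Gm) :
    SG (a :: L) G g = ∑ o, SG L G (Function.update g a o) := by
  unfold SG
  rw [List.foldr_cons]

theorem SG_perm {L L' : List ℕ} (h : L.Perm L') (G : Gm → ZMod 2) : SG L G = SG L' G := by
  unfold SG
  have : LeftCommutative (fun a (G : Gm → ZMod 2) g => ∑ o, G (Function.update g a o)) := by
    constructor
    intro a b G
    by_cases h : a = b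
    · rw [h]
    funext g
    simp only
    rw [Finset.sum_comm]
    simp only [Function.update_comm h]
  exact h.foldr_eq G

theorem SG_congr (a : ℕ) (o : Option (Fin 24)) (L : List ℕ) (ha : a ∉ L) (G G' : Gm → ZMod 2)
    (h : ∀ g, g a = o → G g = G' g) (g : Gm) (hg : g a = o) : SG L G g = SG L G' g := by
  induction L generalizing g with
  | nil => exact h g hg
  | cons b L ih =>
    rw [SG_cons, SG_cons]
    refine Finset.sum_congr rfl fun q _ => ih (fun hh => ha (by simp [hh])) _ ?_
    rw [Function.update_of_ne (fun hh => ha (by simp [hh])), hg]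

theorem SG_zero (L : List ℕ) (g : Gm) : SG L (fun _ => 0) g = 0 := by
  induction L generalizing g with
  | nil => rfl
  | cons b L ih => rw [SG_cons]; simp [ih]

theorem SS_vanish (a : ℕ) (κ : Kap) (L : List ℕ) (ha : a ∉ L) (G : (ℕ → Kap) → ZMod 2)
    (h : ∀ ρ, ρ a = κ → G ρ = 0) (ρ : ℕ → Kap) (hg : ρ a = κ) : SS L G ρ = 0 := by
  induction L generalizing ρ with
  | nil => exact h ρ hg
  | cons b L ih =>
    rw [SS_cons]
    refine Finset.sum_eq_zero fun q _ => ih (fun hh => ha (by simp [hh])) _ ?_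
    rw [Function.update_of_ne (fun hh => ha (by simp [hh])), hg]

def emb (π : ℕ → Bool) (g : Gm) : ℕ → Kap := fun a => .inl (π a, g a)

theorem SS_SG (π : ℕ → Bool) (L : List ℕ) (hL : L.Nodup) (G : (ℕ → Kap) → ZMod 2)
    (h : ∀ ρ, ∀ a ∈ L, (∀ o, ρ a ≠ .inl (π a, o)) → G ρ = 0) (g : Gm) :
    SS L G (emb π g) = SG L (fun g => G (emb π g)) g := by
  induction L generalizing g with
  | nil => rfl
  | cons a L ih =>
    rw [SS_cons, SG_cons]
    rw [List.nodup_cons] at hL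
    symm
    refine Fintype.sum_of_injective (fun o : Option (Fin 24) => (Sum.inl (π a, o) : Kap)) ?_ _ _ ?_ ?_
    · intro o o' h
      simpa using h
    · intro κ hκ
      refine SS_vanish a κ L hL.1 G ?_ _ (by simp)
      intro ρ hρ
      refine h ρ a (by simp) ?_
      intro o ho
      exact hκ ⟨o, ho.symm.trans hρ⟩
    · intro o
      have e : Function.update (emb π g) a (Sum.inl (π a, o)) = emb π (Function.update g a o) := by
        funext b
        by_cases hb : b = a
        · subst hb; simp [emb]
        · simp [emb, hb]
      rw [e, ih hL.2 (fun ρ b hb => h ρ b (by simp [hb]))]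

def dfs : GDiagram → List ℕ → Gm → X → X → ℕ
  | [], _, _, x, y => if x = y then 1 else 0
  | e :: D, l, g, x, y =>
    if e.1 ∈ l then
      dfs D (l.erase e.1) (Function.update g e.1 none) (idle x) y +
      dfs D (l.erase e.1) (Function.update g e.1 (some (if e.2 then tau (idx x) else idx x))) (adv x) y
    else
      match g e.1 with
      | none => dfs D l g (idle x) y
      | some i => if idx x = (if e.2 then tau i else i) then dfs D l g (adv x) y else 0

def parOK (π : ℕ → Bool) : GDiagram → Bool → Prop
  | [], _ => True
  | e :: D, p => π e.1 = p ∧ parOK π D (!p)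

theorem wd_none (π : ℕ → Bool) (g : Gm) (e : Endpoint) (D : GDiagram) (x y : X)
    (hp : π e.1 = par x) (h : g e.1 = none) :
    wd (emb π g) (e :: D) x y = wd (emb π g) D (idle x) y := by
  rw [wd_cons, Matrix.mul_apply, Finset.sum_eq_single (idle x)]
  · simp [letter, emb, h, M, hp]
  · intro z _ hz
    simp [letter, emb, h, M, hz]
  · simp

theorem wd_some (π : ℕ → Bool) (g : Gm) (e : Endpoint) (D : GDiagram) (x y : X)
    (hp : π e.1 = par x) (i : Fin 24) (h : g e.1 = some i) :
    wd (emb π g) (e :: D) x y =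
      if idx x = (if e.2 then tau i else i) then wd (emb π g) D (adv x) y else 0 := by
  rw [wd_cons, Matrix.mul_apply, Finset.sum_eq_single (adv x)]
  · simp [letter, emb, h, M, hp]
  · intro z _ hz
    simp [letter, emb, h, M, hz]
  · simp

theorem dfs_spec (π : ℕ → Bool) (D : GDiagram) (l : List ℕ) (g : Gm) (x y : X) (hl : l.Nodup)
    (hm : ∀ a ∈ l, ∃ t, (a, t) ∈ D) (hp : parOK π D (par x)) :
    SG l (fun g => wd (emb π g) D x y) g = (dfs D l g x y : ZMod 2) := by
  induction D generalizing l g x with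
  | nil =>
    have : l = [] := by
      rw [List.eq_nil_iff_forall_not_mem]
      intro a ha
      obtain ⟨t, ht⟩ := hm a ha
      simp at ht
    subst this
    rw [SG_nil, wd_nil, dfs, Matrix.one_apply]
    split_ifs <;> simp
  | cons e D ih =>
    obtain ⟨hp1, hp2⟩ := hp
    have ih1 : ∀ l g, l.Nodup → (∀ a ∈ l, ∃ t, (a, t) ∈ D) →
      SG l (fun g => wd (emb π g) D (idle x) y) g = (dfs D l g (idle x) y : ZMod 2) :=
      fun l g h1 h2 => ih l g (idle x) h1 h2 (by rw [par_idle]; exact hp2)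
    have ih2 : ∀ l g, l.Nodup → (∀ a ∈ l, ∃ t, (a, t) ∈ D) →
      SG l (fun g => wd (emb π g) D (adv x) y) g = (dfs D l g (adv x) y : ZMod 2) :=
      fun l g h1 h2 => ih l g (adv x) h1 h2 (by rw [par_adv]; exact hp2)
    have hm' : ∀ a ∈ l, a ≠ e.1 → ∃ t, (a, t) ∈ D := by
      intro a ha hne
      obtain ⟨t, ht⟩ := hm a ha
      rw [List.mem_cons] at ht
      rcases ht with ht | ht
      · exact absurd (congrArg Prod.fst ht) hne
      · exact ⟨t, ht⟩
    have hnone : ∀ l g, e.1 ∉ l → l.Nodup → (∀ a ∈ l, ∃ t, (a, t) ∈ D) → g e.1 = none →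
        SG l (fun g => wd (emb π g) (e :: D) x y) g = (dfs D l g (idle x) y : ZMod 2) := by
      intro l g h0 h1 h2 h3
      rw [← ih1 l g h1 h2]
      exact SG_congr e.1 none l h0 _ _ (fun g hg => wd_none π g e D x y hp1 hg) g h3
    have hsome : ∀ l g i, e.1 ∉ l → l.Nodup → (∀ a ∈ l, ∃ t, (a, t) ∈ D) → g e.1 = some i →
        SG l (fun g => wd (emb π g) (e :: D) x y) g =
          if idx x = (if e.2 then tau i else i) then (dfs D l g (adv x) y : ZMod 2) else 0 := by
      intro l g i h0 h1 h2 h3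
      by_cases hc : idx x = (if e.2 then tau i else i)
      · rw [if_pos hc, ← ih2 l g h1 h2]
        refine SG_congr e.1 (some i) l h0 _ _ (fun g hg => ?_) g h3
        rw [wd_some π g e D x y hp1 i hg, if_pos hc]
      · rw [if_neg hc, ← SG_zero l g]
        refine SG_congr e.1 (some i) l h0 _ _ (fun g hg => ?_) g h3
        rw [wd_some π g e D x y hp1 i hg, if_neg hc]
    by_cases ha : e.1 ∈ l
    · have hn : e.1 ∉ l.erase e.1 := hl.not_mem_erase
      have hnd : (l.erase e.1).Nodup := hl.erase _
      have hme : ∀ a ∈ l.erase e.1, ∃ t, (a, t) ∈ D := fun a h =>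
        hm' a (List.mem_of_mem_erase h) (fun hh => hn (hh ▸ h))
      rw [SG_perm (List.perm_cons_erase ha), SG_cons, Fintype.sum_option, dfs, if_pos ha, Nat.cast_add]
      rw [hnone _ (Function.update g e.1 none) hn hnd hme (by simp)]
      refine congrArg (_ + ·) ?_
      · rw [Finset.sum_eq_single (if e.2 then tau (idx x) else idx x)]
        · rw [hsome _ _ (if e.2 then tau (idx x) else idx x) hn hnd hme (by simp), if_pos]
          cases e.2 <;> simp [tau_tau]
        · intro i _ hi
          rw [hsome _ _ i hn hnd hme (by simp), if_neg]
          intro hc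
          apply hi
          rw [hc]
          cases e.2 <;> simp [tau_tau]
        · simp
    · have hme : ∀ a ∈ l, ∃ t, (a, t) ∈ D := fun a h => hm' a h (fun hh => ha (hh ▸ h))
      rw [dfs, if_neg ha]
      cases hg : g e.1 with
      | none => exact hnone _ _ ha hl hme hg
      | some i =>
        rw [hsome _ _ i ha hl hme hg]
        simp only
        split_ifs <;> simp

def W1 : GDiagram := [(0, false), (1, false), (0, true), (2, true), (3, true), (4, true), (3, false),
  (1, true), (5, true), (4, false), (5, false), (2, false)]
def W2 : GDiagram := [(6, false), (7, false), (8, true), (9, true), (6, true), (10, true), (8, false),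
  (10, false), (11, true), (7, true), (11, false), (9, false)]

set_option maxRecDepth 100000 in
theorem dfs_total : (∑ x : Fin 24 × Bool, dfs (W1 ++ W2) [0, 1, 2, 3, 4, 5, 6, 7, 8, 9, 10, 11]
    (fun _ => none) (x.1, x.2, false) (x.1, x.2, false)) = 49 := by
  decide +kernel

def pi0 (n : ℕ) : Bool := n ∈ [1, 2, 4, 7, 9, 10]

def L0 : List ℕ := [0, 1, 2, 3, 4, 5, 6, 7, 8, 9, 10, 11]

theorem SG_sum (L : List ℕ) (F : X → Gm → ZMod 2) (g : Gm) :
    SG L (fun g => ∑ x, F x g) g = ∑ x, SG L (F x) g := by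
  induction L generalizing g with
  | nil => rw [SG_nil]; simp only [SG_nil]
  | cons b L ih =>
    rw [SG_cons]
    simp only [SG_cons, ih]
    rw [Finset.sum_comm]

theorem SG_ite (L : List ℕ) (c : Prop) [Decidable c] (F : Gm → ZMod 2) (g : Gm) :
    SG L (fun g => if c then F g else 0) g = if c then SG L F g else 0 := by
  by_cases h : c
  · simp only [h, if_true]
  · simp only [h, if_false, SG_zero]

theorem vanish (ρ : ℕ → Kap) (a : ℕ) (ha : a ∈ L0) (h : ∀ o, ρ a ≠ .inl (pi0 a, o)) :
    trp false (wd ρ (W1 ++ W2)) = 0 := by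
  rw [trp_apply]
  refine Finset.sum_eq_zero fun x _ => ?_
  by_cases hx : par x = false
  swap
  · rw [if_neg hx]
  rw [if_pos hx]
  by_contra hne
  have hr := wd_req _ _ _ _ hne
  rw [hx] at hr
  simp only [W1, W2, List.cons_append, List.nil_append, reqOK, Bool.not_false, Bool.not_true] at hr
  obtain ⟨r0, r1, r2, r3, r4, r5, r6, r7, r8, r9, r10, r11, r12, r13, r14, r15, r16, r17, r18, r19,
    r20, r21, r22, r23, -⟩ := hr
  have key : ∀ c, req (ρ a) false = c → req (ρ a) true = c → c = pi0 a → False := by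
    rintro c h1 h2 rfl
    obtain ⟨o, ho⟩ := req_both _ _ h1 h2
    exact h o ho
  simp only [L0, List.mem_cons, List.not_mem_nil, or_false] at ha
  rcases ha with rfl | rfl | rfl | rfl | rfl | rfl | rfl | rfl | rfl | rfl | rfl | rfl
  all_goals
    refine key _ ?_ ?_ rfl <;> simp only [pi0] <;> assumption

theorem notQ : ¬ Q (W1 ++ W2) := by
  intro h
  have h1 := h false (emb pi0 (fun _ => none))
  unfold Z at h1
  rw [SS_perm (show (heads (W1 ++ W2)).Perm L0 by decide),
    SS_SG pi0 L0 (by decide) (fun ρ => trp false (wd ρ (W1 ++ W2))) vanish] at h1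
  simp only [trp_apply] at h1
  rw [SG_sum L0 (fun x g => if par x = false then wd (emb pi0 g) (W1 ++ W2) x x else 0)] at h1
  simp only [SG_ite] at h1
  have e : ∀ x : X, (if par x = false then
      SG L0 (fun g => wd (emb pi0 g) (W1 ++ W2) x x) (fun _ => none) else 0) =
      if par x = false then (dfs (W1 ++ W2) L0 (fun _ => none) x x : ZMod 2) else 0 := by
    intro x
    by_cases hx : par x = false
    · rw [if_pos hx, if_pos hx]
      refine dfs_spec pi0 _ _ _ _ _ (by decide) ?_ ?_
      · intro a ha
        have : ∀ a ∈ L0, (a, true) ∈ W1 ++ W2 := by decide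
        exact ⟨true, this a ha⟩
      · rw [hx]
        simp [parOK, W1, W2, pi0]
    · rw [if_neg hx, if_neg hx]
  simp only [e] at h1
  have h2 := congrArg (Nat.cast : ℕ → ZMod 2) dfs_total
  rw [Nat.cast_sum] at h2
  have h3 : ∑ x : Fin 24 × Bool, ((dfs (W1 ++ W2) [0, 1, 2, 3, 4, 5, 6, 7, 8, 9, 10, 11]
      (fun _ => none) (x.1, x.2, false) (x.1, x.2, false) : ℕ) : ZMod 2) =
      ∑ x : X, if par x = false then (dfs (W1 ++ W2) L0 (fun _ => none) x x : ZMod 2) else 0 := by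
    refine Fintype.sum_of_injective (fun q : Fin 24 × Bool => ((q.1, q.2, false) : X)) ?_ _ _ ?_ ?_
    · rintro ⟨a, b⟩ ⟨c, d⟩ h
      simpa using h
    · rintro ⟨z, d, p⟩ hx
      cases p
      · exact absurd ⟨(z, d), rfl⟩ hx
      · rfl
    · intro q
      exact (if_pos (show par ((q.1, q.2, false) : X) = false from rfl)).symm
  rw [h3, h1] at h2
  revert h2
  decide

theorem gauss_of (D : GDiagram)
    (h : ∀ e ∈ D, List.count (e.1, true) D = 1 ∧ List.count (e.1, false) D = 1) : IsGauss D := by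
  intro a
  by_cases h1 : ∃ s, (a, s) ∈ D
  · obtain ⟨s, hs⟩ := h1
    exact Or.inr (h _ hs)
  · left
    push Not at h1
    exact ⟨List.count_eq_zero.2 (h1 _), List.count_eq_zero.2 (h1 _)⟩

theorem same_rot (u v : GDiagram) : Same (u ++ v) (v ++ u) :=
  ⟨id, u, v, Function.injective_id, rfl, by simp [relabel]⟩

theorem same_refl (D : GDiagram) : Same D D := by
  have := same_rot D []
  simpa using this

/-- A cyclic FR2 deletion with the tails at the seam. -/
theorem fr2_seam (x y z t : ℕ) (u v : GDiagram) (hxy : x ≠ y) (h : ({z, t} : Set ℕ) = {x, y})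
    (hg : IsGauss ((t, false) :: (u ++ [(x, true), (y, true)] ++ v ++ [(z, false)])))
    (hg' : IsGauss (u ++ v)) :
    FlatEq ((t, false) :: (u ++ [(x, true), (y, true)] ++ v ++ [(z, false)])) (u ++ v) := by
  refine Relation.EqvGen.rel _ _ ⟨hg, hg', Or.inr (Or.inr (Or.inl ?_))⟩
  refine ⟨_, _, same_rot [(t, false)] (u ++ [(x, true), (y, true)] ++ v ++ [(z, false)]),
    ⟨x, y, x, y, z, t, u, v, [], hxy, rfl, h, by simp, rfl⟩, ?_⟩
  rw [List.append_nil]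
  exact same_refl _

/-- A cyclic FR2 deletion inside the word. -/
theorem fr2_in (x y z t : ℕ) (u v w : GDiagram) (hxy : x ≠ y) (h : ({z, t} : Set ℕ) = {x, y})
    (hg : IsGauss (u ++ [(x, true), (y, true)] ++ v ++ [(z, false), (t, false)] ++ w))
    (hg' : IsGauss (u ++ v ++ w)) :
    FlatEq (u ++ [(x, true), (y, true)] ++ v ++ [(z, false), (t, false)] ++ w) (u ++ v ++ w) := by
  refine Relation.EqvGen.rel _ _ ⟨hg, hg', Or.inr (Or.inr (Or.inl ?_))⟩
  exact ⟨_, _, same_refl _, ⟨x, y, x, y, z, t, u, v, w, hxy, rfl, h, rfl, rfl⟩, same_refl _⟩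

theorem W1_triv : FlatEq W1 [] := by
  refine Relation.EqvGen.trans _ [(1, false), (3, true), (4, true), (3, false),
    (1, true), (5, true), (4, false), (5, false)] _ ?_ ?_
  · exact fr2_seam 0 2 2 0 [(1, false)] [(3, true), (4, true), (3, false),
      (1, true), (5, true), (4, false), (5, false)] (by decide) (Set.pair_comm _ _)
      (gauss_of _ (by decide)) (gauss_of _ (by decide))
  refine Relation.EqvGen.trans _ [(3, true), (4, true), (3, false), (4, false)] _ ?_ ?_
  · exact fr2_seam 1 5 5 1 [(3, true), (4, true), (3, false)] [(4, false)]
      (by decide) (Set.pair_comm _ _)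
      (gauss_of _ (by decide)) (gauss_of _ (by decide))
  · exact fr2_in 3 4 3 4 [] [] [] (by decide) rfl (gauss_of _ (by decide)) (gauss_of _ (by decide))

theorem W2_triv : FlatEq W2 [] := by
  refine Relation.EqvGen.trans _ [(7, false), (8, true), (10, true), (8, false),
  (10, false), (11, true), (7, true), (11, false)] _ ?_ ?_
  · exact fr2_seam 9 6 9 6 [(7, false), (8, true)] [(10, true), (8, false),
      (10, false), (11, true), (7, true), (11, false)] (by decide) rfl
      (gauss_of _ (by decide)) (gauss_of _ (by decide))
  refine Relation.EqvGen.trans _ [(8, true), (10, true), (8, false), (10, false)] _ ?_ ?_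
  · exact fr2_seam 11 7 11 7 [(8, true), (10, true), (8, false), (10, false)] []
      (by decide) rfl
      (gauss_of _ (by decide)) (gauss_of _ (by decide))
  · exact fr2_in 8 10 8 10 [] [] [] (by decide) rfl (gauss_of _ (by decide)) (gauss_of _ (by decide))

theorem gauss_nil : IsGauss [] := gauss_of _ (by simp)

theorem crKnot_triv {D : GDiagram} (h : FlatEq D []) : crKnot D = 0 := by
  unfold crKnot
  rw [Nat.sInf_eq_zero]
  exact Or.inl ⟨[], gauss_nil, h, rfl⟩

theorem crKnot_pos {D : GDiagram} (hg : IsGauss D) (h : ¬ FlatEq D []) : 0 < crKnot D := by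
  rw [Nat.pos_iff_ne_zero]
  intro h0
  have hm : crKnot D ∈ {n : ℕ | ∃ E : GDiagram, IsGauss E ∧ FlatEq D E ∧ cr E = n} :=
    Nat.sInf_mem ⟨_, D, hg, Relation.EqvGen.refl _, rfl⟩
  rw [h0] at hm
  obtain ⟨E, hE, hDE, hc⟩ := hm
  unfold cr at hc
  rcases E with _ | ⟨⟨a, s⟩, _ | ⟨f, E⟩⟩
  · exact h hDE
  · have := hE a
    cases s <;> simp at this
  · simp at hc

end FlatInv

/-- There exist Gauss diagrams `D1`, `D2`, each
representing the trivial flat virtual knot (flat equivalent to the empty Gauss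
diagram), together with choices of basepoints (encoded in the lists `D1`,
`D2` themselves), whose connected sum `D1 ++ D2` represents a nontrivial
flat virtual knot; consequently the super-additivity inequality for crossing
numbers under connected sum can be strict. -/
theorem connSum_of_trivials_can_be_nontrivial :
    ∃ D1 D2 : GDiagram, IsGauss D1 ∧ IsGauss D2 ∧ LabelDisjoint D1 D2 ∧
      FlatEq D1 [] ∧ FlatEq D2 [] ∧ ¬ FlatEq (D1 ++ D2) [] ∧
      crKnot (D1 ++ D2) > crKnot D1 + crKnot D2 := by
  refine ⟨FlatInv.W1, FlatInv.W2, FlatInv.gauss_of _ (by decide), FlatInv.gauss_of _ (by decide), ?_,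
    FlatInv.W1_triv, FlatInv.W2_triv, ?_, ?_⟩
  · intro a s t h1 h2
    have : ∀ e ∈ FlatInv.W1, ∀ f ∈ FlatInv.W2, e.1 ≠ f.1 := by decide
    exact this _ h1 _ h2 rfl
  · exact fun h => FlatInv.notQ ((FlatInv.Q_flat h).2 FlatInv.Q_nil)
  · rw [FlatInv.crKnot_triv FlatInv.W1_triv, FlatInv.crKnot_triv FlatInv.W2_triv]
    exact FlatInv.crKnot_pos (FlatInv.gauss_of _ (by decide))
      (fun h => FlatInv.notQ ((FlatInv.Q_flat h).2 FlatInv.Q_nil))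
end

section
/- The connected sum of flat virtual knots depends on the choice of basepoints: there exist Gauss diagrams D1 and D2 and two different choices of basepoints on them such that the two resulting connected sum Gauss diagrams represent flat-inequivalent flat virtual knots. -/
set_option linter.unusedSimpArgs false

def Rr (w : ℕ → ℤ) : List ℕ → ℕ → ℤ
  | [], _ => 1
  | x :: L, a => w x ^ (L.count a) * Rr w L a

def Tt (k : ℕ → ℤ) : List ℕ → ℤ
  | [] => 0
  | x :: L => k x - Tt k L

def Pp (L : List ℕ) : ℕ → ℤ := Rr (fun _ => -1) L
def Qq (L : List ℕ) : ℕ → ℤ := Rr (Pp L) L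
def Kk (L : List ℕ) (a : ℕ) : ℤ := (1 + Pp L a) * Qq L a
def Ii (L : List ℕ) : ℤ := Tt (Kk L) L

def GG (L : List ℕ) : Prop := ∀ a, L.count a = 0 ∨ L.count a = 2

theorem Rr_append (w : ℕ → ℤ) (u v : List ℕ) (a : ℕ) :
    Rr w (u ++ v) a = Rr w u a * (u.map w).prod ^ (v.count a) * Rr w v a := by
  induction u with
  | nil => simp [Rr]
  | cons x u ih =>
    simp only [List.cons_append, Rr, ih, List.count_append, List.map_cons, List.prod_cons, mul_pow,
      pow_add]
    ring

theorem Tt_append (k : ℕ → ℤ) (u v : List ℕ) :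
    Tt k (u ++ v) = Tt k u + (-1) ^ u.length * Tt k v := by
  induction u with
  | nil => simp [Tt]
  | cons x u ih => simp only [List.cons_append, Tt, ih, List.length_cons, pow_succ]; ring

theorem Rr_not {w : ℕ → ℤ} {u : List ℕ} {a : ℕ} (h : u.count a = 0) : Rr w u a = 1 := by
  induction u with
  | nil => rfl
  | cons x u ih =>
    rw [List.count_cons] at h
    have h1 : u.count a = 0 := by omega
    simp [Rr, h1, ih h1]

theorem Rr_congr {w w' : ℕ → ℤ} {u : List ℕ} (a : ℕ) (h : ∀ x ∈ u, w x = w' x) :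
    Rr w u a = Rr w' u a := by
  induction u with
  | nil => rfl
  | cons x u ih =>
    simp only [Rr]
    rw [h x (by simp), ih (fun y hy => h y (by simp [hy]))]

theorem Tt_congr {w w' : ℕ → ℤ} {u : List ℕ} (h : ∀ x ∈ u, w x = w' x) :
    Tt w u = Tt w' u := by
  induction u with
  | nil => rfl
  | cons x u ih =>
    simp only [Tt]
    rw [h x (by simp), ih (fun y hy => h y (by simp [hy]))]

theorem sq_prod {w : ℕ → ℤ} (hw : ∀ x, w x * w x = 1) (u : List ℕ) :
    (u.map w).prod * (u.map w).prod = 1 := by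
  induction u with
  | nil => simp
  | cons x u ih =>
    simp only [List.map_cons, List.prod_cons]
    linear_combination (w x * w x) * ih + hw x

theorem sq_Rr {w : ℕ → ℤ} (hw : ∀ x, w x * w x = 1) (u : List ℕ) (a : ℕ) :
    Rr w u a * Rr w u a = 1 := by
  induction u with
  | nil => simp [Rr]
  | cons x u ih =>
    simp only [Rr]
    have : w x ^ (u.count a) * w x ^ (u.count a) = 1 := by rw [← mul_pow, hw, one_pow]
    linear_combination (w x ^ (u.count a) * w x ^ (u.count a)) * ih + this

theorem sq_Pp (u : List ℕ) (a : ℕ) : Pp u a * Pp u a = 1 := sq_Rr (by simp) u a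

theorem GG_prod {w : ℕ → ℤ} (hw : ∀ x, w x * w x = 1) {L : List ℕ} (h : GG L) :
    (L.map w).prod = 1 := by
  rw [Finset.prod_list_map_count]
  apply Finset.prod_eq_one
  intro x _
  rcases h x with h | h <;> simp [h, pow_two, hw]

theorem GG_len {L : List ℕ} (h : GG L) : (-1 : ℤ) ^ L.length = 1 := by
  have := GG_prod (w := fun _ => -1) (by simp) h
  simpa using this

theorem GG_perm {L L' : List ℕ} (p : L.Perm L') (h : GG L) : GG L' := by
  intro a; rw [← p.count_eq]; exact h a

theorem Rr_rot {w : ℕ → ℤ} (hw : ∀ x, w x * w x = 1) {x : ℕ} {L : List ℕ} (h : GG (x :: L)) (a : ℕ) :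
    Rr w (L ++ [x]) a = Rr w (x :: L) a := by
  have hp := GG_prod hw h
  simp only [List.map_cons, List.prod_cons] at hp
  rw [Rr_append]
  by_cases hx : x = a
  · subst hx
    have h1 : L.count x = 1 := by
      have := h x
      simp at this; omega
    simp [Rr, h1]
    linear_combination (-Rr w L x * (L.map w).prod) * hw x + w x * Rr w L x * hp
  · have h1 : L.count a = 0 ∨ L.count a = 2 := by
      have := h a
      simpa [List.count_cons, hx] using this
    have h2 : w x ^ L.count a = 1 := by rcases h1 with h1 | h1 <;> simp [h1, pow_two, hw]
    simp [Rr, h2, hx]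

theorem Ii_rot1 {x : ℕ} {L : List ℕ} (h : GG (x :: L)) : Ii (L ++ [x]) = - Ii (x :: L) := by
  have hP : Pp (L ++ [x]) = Pp (x :: L) := funext fun a => Rr_rot (by simp) h a
  have hQ : Qq (L ++ [x]) = Qq (x :: L) := by
    funext a; unfold Qq; rw [hP]; exact Rr_rot (sq_Pp _) h a
  have hK : Kk (L ++ [x]) = Kk (x :: L) := by funext a; unfold Kk; rw [hP, hQ]
  have hl := GG_len h
  simp only [List.length_cons, pow_succ] at hl
  unfold Ii
  rw [hK, Tt_append]
  simp only [Tt]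
  linear_combination (-Kk (x :: L) x) * hl

theorem Ii_rot (u v : List ℕ) (h : GG (u ++ v)) : |Ii (v ++ u)| = |Ii (u ++ v)| := by
  induction u generalizing v with
  | nil => simp
  | cons x u ih =>
    have h2 : GG (u ++ (v ++ [x])) := by
      refine GG_perm ?_ h
      rw [← List.append_assoc]
      exact (List.perm_append_singleton x (u ++ v)).symm
    have := ih (v ++ [x]) h2
    rw [List.append_assoc] at this
    simp only [List.cons_append, List.nil_append] at this ⊢
    rw [this, ← List.append_assoc, Ii_rot1 (L := u ++ v) h, abs_neg]

theorem Rr_map (f : ℕ → ℕ) (hf : Function.Injective f) (w : ℕ → ℤ) (L : List ℕ) (a : ℕ) :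
    Rr w (L.map f) (f a) = Rr (fun x => w (f x)) L a := by
  induction L with
  | nil => rfl
  | cons x L ih => simp [Rr, ih, List.count_map_of_injective _ _ hf]

theorem Tt_map (f : ℕ → ℕ) (k : ℕ → ℤ) (L : List ℕ) :
    Tt k (L.map f) = Tt (fun x => k (f x)) L := by
  induction L with
  | nil => rfl
  | cons x L ih => simp [Tt, ih]

theorem Ii_map (f : ℕ → ℕ) (hf : Function.Injective f) (L : List ℕ) : Ii (L.map f) = Ii L := by
  have hP : ∀ a, Pp (L.map f) (f a) = Pp L a := fun a => Rr_map f hf _ L a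
  have hQ : ∀ a, Qq (L.map f) (f a) = Qq L a := by
    intro a; unfold Qq; rw [Rr_map f hf]; simp only [hP]
  unfold Ii; rw [Tt_map]; unfold Kk; simp only [hP, hQ]

theorem GG_map (f : ℕ → ℕ) (hf : Function.Injective f) (L : List ℕ) : GG (L.map f) ↔ GG L := by
  constructor
  · intro h a
    have := h (f a)
    rwa [List.count_map_of_injective _ _ hf] at this
  · intro h a
    by_cases ha : a ∈ L.map f
    · obtain ⟨b, -, rfl⟩ := List.mem_map.1 ha
      rw [List.count_map_of_injective _ _ hf]; exact h b
    · left; exact List.count_eq_zero_of_not_mem ha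

/- FR1 -/
theorem Ii_r1 (a : ℕ) (L : List ℕ) (h : GG (a :: a :: L)) : Ii (a :: a :: L) = Ii L := by
  have ha : L.count a = 0 := by have := h a; simp at this; omega
  have key : ∀ w : ℕ → ℤ, (∀ x, w x * w x = 1) → ∀ b ∈ L, Rr w (a :: a :: L) b = Rr w L b := by
    intro w hw b hb
    have hab : a ≠ b := by rintro rfl; exact (List.count_eq_zero.1 ha) hb
    have : w a ^ L.count b * w a ^ L.count b = 1 := by rw [← mul_pow, hw, one_pow]
    simp only [Rr, List.count_cons_of_ne hab]
    rw [← mul_assoc, this, one_mul]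
  have hP : ∀ b ∈ L, Pp (a :: a :: L) b = Pp L b := key _ (by simp)
  have hQ : ∀ b ∈ L, Qq (a :: a :: L) b = Qq L b := by
    intro b hb
    unfold Qq
    rw [key _ (sq_Pp _) b hb]
    exact Rr_congr b hP
  unfold Ii
  simp only [Tt, sub_sub_cancel]
  apply Tt_congr
  intro b hb
  unfold Kk
  rw [hP b hb, hQ b hb]

/- FR2 -/
theorem Ii_r2 (x y z t : ℕ) (v w : List ℕ) (hxy : x ≠ y) (hc : (z = x ∧ t = y) ∨ (z = y ∧ t = x))
    (h : GG (x :: y :: (v ++ z :: t :: w))) :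
    Ii (x :: y :: (v ++ z :: t :: w)) = Ii (v ++ w) := by
  have hyx := hxy.symm
  have hx : v.count x = 0 ∧ w.count x = 0 := by
    have := h x
    rcases hc with ⟨rfl, rfl⟩ | ⟨rfl, rfl⟩ <;> simp [List.count_cons, hxy, hyx] at this <;> omega
  have hy : v.count y = 0 ∧ w.count y = 0 := by
    have := h y
    rcases hc with ⟨rfl, rfl⟩ | ⟨rfl, rfl⟩ <;> simp [List.count_cons, hxy, hyx] at this <;> omega
  obtain ⟨hx1, hx2⟩ := hx
  obtain ⟨hy1, hy2⟩ := hy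
  set L := x :: y :: (v ++ z :: t :: w) with hL
  have mem : ∀ b ∈ v ++ w, b ≠ x ∧ b ≠ y := by
    intro b hb
    rw [List.count_eq_zero] at *
    constructor <;> rintro rfl <;> simp_all
  have key : ∀ k : ℕ → ℤ, (∀ x, k x * k x = 1) → k x = k y →
      ∀ b ∈ v ++ w, Rr k L b = Rr k (v ++ w) b := by
    intro k hk e b hb
    obtain ⟨m1, m2⟩ := mem b hb
    have e2 : ∀ n, k y ^ n * k y ^ n = 1 := fun n => by rw [← mul_pow, hk, one_pow]
    rcases hc with ⟨rfl, rfl⟩ | ⟨rfl, rfl⟩ <;>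
    simp only [hL, Rr, Rr_append, e, List.count_append, List.count_cons_of_ne m1.symm,
        List.count_cons_of_ne m2.symm] <;>
    · rw [← mul_assoc, e2, one_mul]
      linear_combination (Rr k v b * (List.map k v).prod ^ List.count b w * Rr k w b) * e2 (w.count b)
  have key2 : ∀ k : ℕ → ℤ, (∀ x, k x * k x = 1) → k x = k y → Rr k L x = Rr k L y := by
    intro k hk e
    rcases hc with ⟨rfl, rfl⟩ | ⟨rfl, rfl⟩ <;>
    simp [hL, Rr, Rr_append, e, List.count_cons, hxy, hyx, hx1, hx2, hy1, hy2, Rr_not, pow_two, hk] <;>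
    grind
  have hPxy : Pp L x = Pp L y := key2 _ (by simp) rfl
  have hQxy : Qq L x = Qq L y := key2 _ (sq_Pp _) hPxy
  have hP : ∀ b ∈ v ++ w, Pp L b = Pp (v ++ w) b := key _ (by simp) rfl
  have hQ : ∀ b ∈ v ++ w, Qq L b = Qq (v ++ w) b := by
    intro b hb
    unfold Qq
    rw [key _ (sq_Pp _) hPxy b hb]
    exact Rr_congr b hP
  have hK : Kk L x = Kk L y := by unfold Kk; rw [hPxy, hQxy]
  have hK2 : Tt (Kk L) (v ++ w) = Ii (v ++ w) := by
    apply Tt_congr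
    intro b hb
    unfold Kk
    rw [hP b hb, hQ b hb]
  rw [← hK2]
  unfold Ii
  generalize Kk L = k at *
  rcases hc with ⟨rfl, rfl⟩ | ⟨rfl, rfl⟩ <;>
  simp [hL, Tt, Tt_append, hK]

/- FR3 -/
theorem Ii_r3core (a b c : ℕ) (L L' : List ℕ)
    (h0 : ∀ w d, d ≠ a → d ≠ b → d ≠ c → Rr w L' d = Rr w L d)
    (ha : ∀ w : ℕ → ℤ, (∀ x, w x * w x = 1) → Rr w L' a = Rr w L a * (w b * w c))
    (hb : ∀ w : ℕ → ℤ, (∀ x, w x * w x = 1) → Rr w L' b = Rr w L b * (w a * w c))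
    (hc : ∀ w : ℕ → ℤ, (∀ x, w x * w x = 1) → Rr w L' c = Rr w L c * (w a * w b))
    (hp : Pp L a * Pp L b * Pp L c = -1)
    (hT : ∀ k k' : ℕ → ℤ, (∀ d, d ≠ a → d ≠ b → d ≠ c → k' d = k d) → k' a = - k a → k' b = - k b →
      k' c = - k c → Tt k' L' = Tt k L) : Ii L' = Ii L := by
  have hP : Pp L' = Pp L := by
    funext d
    unfold Pp
    by_cases h1 : d = a
    · subst h1; simp [ha]
    by_cases h2 : d = b
    · subst h2; simp [hb]
    by_cases h3 : d = c
    · subst h3; simp [hc]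
    exact h0 _ d h1 h2 h3
  have sa := sq_Pp L a
  have sb := sq_Pp L b
  have sc := sq_Pp L c
  have e1 : Pp L b * Pp L c = - Pp L a := by
    linear_combination (- Pp L b * Pp L c) * sa + Pp L a * hp
  have e2 : Pp L a * Pp L c = - Pp L b := by
    linear_combination (- Pp L a * Pp L c) * sb + Pp L b * hp
  have e3 : Pp L a * Pp L b = - Pp L c := by
    linear_combination (- Pp L a * Pp L b) * sc + Pp L c * hp
  unfold Ii
  apply hT
  · intro d h1 h2 h3
    unfold Kk Qq
    rw [hP, h0 _ d h1 h2 h3]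
  · unfold Kk Qq
    rw [hP, ha _ (sq_Pp L), e1]
    linear_combination (-Rr (Pp L) L a) * sa
  · unfold Kk Qq
    rw [hP, hb _ (sq_Pp L), e2]
    linear_combination (-Rr (Pp L) L b) * sb
  · unfold Kk Qq
    rw [hP, hc _ (sq_Pp L), e3]
    linear_combination (-Rr (Pp L) L c) * sc

theorem Ii_r3 (a b c x y z t p q : ℕ) (u v w : List ℕ) (hab : a ≠ b) (hac : a ≠ c) (hbc : b ≠ c)
    (hx : x = a ∧ y = b)
    (hc : (z = a ∧ t = c ∧ p = b ∧ q = c) ∨ (z = a ∧ t = c ∧ p = c ∧ q = b) ∨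
      (z = c ∧ t = a ∧ p = b ∧ q = c) ∨ (z = c ∧ t = a ∧ p = c ∧ q = b) ∨
      (z = b ∧ t = c ∧ p = a ∧ q = c) ∨ (z = b ∧ t = c ∧ p = c ∧ q = a) ∨
      (z = c ∧ t = b ∧ p = a ∧ q = c) ∨ (z = c ∧ t = b ∧ p = c ∧ q = a))
    (h : GG (x :: y :: (u ++ z :: t :: (v ++ p :: q :: w)))) :
    Ii (y :: x :: (u ++ t :: z :: (v ++ q :: p :: w))) =
      Ii (x :: y :: (u ++ z :: t :: (v ++ p :: q :: w))) := by
  obtain ⟨rfl, rfl⟩ := hx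
  have hba := hab.symm
  have hca := hac.symm
  have hcb := hbc.symm
  have c0 : ∀ d, d = x ∨ d = y ∨ d = c → u.count d = 0 ∧ v.count d = 0 ∧ w.count d = 0 := by
    intro d hd
    have h1 := h d
    simp only [List.count_cons, List.count_append] at h1
    rcases hc with ⟨rfl, rfl, rfl, rfl⟩ | ⟨rfl, rfl, rfl, rfl⟩ | ⟨rfl, rfl, rfl, rfl⟩ |
      ⟨rfl, rfl, rfl, rfl⟩ | ⟨rfl, rfl, rfl, rfl⟩ | ⟨rfl, rfl, rfl, rfl⟩ | ⟨rfl, rfl, rfl, rfl⟩ |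
      ⟨rfl, rfl, rfl, rfl⟩ <;> rcases hd with rfl | rfl | rfl <;> simp [*] at h1 <;> omega
  obtain ⟨ua, va, wa⟩ := c0 x (by simp)
  obtain ⟨ub, vb, wb⟩ := c0 y (by simp)
  obtain ⟨uc, vc, wc⟩ := c0 c (by simp)
  clear c0 h
  apply Ii_r3core x y c
  · intro k d h1 h2 h3
    have h1 := h1.symm
    have h2 := h2.symm
    have h3 := h3.symm
    rcases hc with ⟨rfl, rfl, rfl, rfl⟩ | ⟨rfl, rfl, rfl, rfl⟩ | ⟨rfl, rfl, rfl, rfl⟩ |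
      ⟨rfl, rfl, rfl, rfl⟩ | ⟨rfl, rfl, rfl, rfl⟩ | ⟨rfl, rfl, rfl, rfl⟩ | ⟨rfl, rfl, rfl, rfl⟩ |
      ⟨rfl, rfl, rfl, rfl⟩ <;>
    simp only [Rr, Rr_append, List.count_append, List.count_cons_of_ne h1,
      List.count_cons_of_ne h2, List.count_cons_of_ne h3] <;> ring
  iterate 3
    · intro k hk
      have hU := sq_prod hk u
      have hV := sq_prod hk v
      have k1 := hk x
      have k2 := hk y
      have k3 := hk c
      rcases hc with ⟨rfl, rfl, rfl, rfl⟩ | ⟨rfl, rfl, rfl, rfl⟩ | ⟨rfl, rfl, rfl, rfl⟩ |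
        ⟨rfl, rfl, rfl, rfl⟩ | ⟨rfl, rfl, rfl, rfl⟩ | ⟨rfl, rfl, rfl, rfl⟩ | ⟨rfl, rfl, rfl, rfl⟩ |
        ⟨rfl, rfl, rfl, rfl⟩ <;>
      (simp only [Rr, Rr_append, List.count_append, List.count_cons_self, List.count_cons_of_ne hab,
        List.count_cons_of_ne hac, List.count_cons_of_ne hbc, List.count_cons_of_ne hba,
        List.count_cons_of_ne hca, List.count_cons_of_ne hcb, ua, ub, uc, va, vb, vc, wa, wb, wc,
        Rr_not ua, Rr_not ub, Rr_not uc, Rr_not va, Rr_not vb, Rr_not vc, Rr_not wa, Rr_not wb,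
        Rr_not wc]
       generalize (List.map k u).prod = U at *
       generalize (List.map k v).prod = V at *
       clear hk ua ub uc va vb vc wa wb wc
       grind)
  · have hU := sq_prod (w := fun _ => -1) (by simp) u
    have hV := sq_prod (w := fun _ => -1) (by simp) v
    unfold Pp
    rcases hc with ⟨rfl, rfl, rfl, rfl⟩ | ⟨rfl, rfl, rfl, rfl⟩ | ⟨rfl, rfl, rfl, rfl⟩ |
      ⟨rfl, rfl, rfl, rfl⟩ | ⟨rfl, rfl, rfl, rfl⟩ | ⟨rfl, rfl, rfl, rfl⟩ | ⟨rfl, rfl, rfl, rfl⟩ |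
      ⟨rfl, rfl, rfl, rfl⟩ <;>
    (simp only [Rr, Rr_append, List.count_append, List.count_cons_self, List.count_cons_of_ne hab,
      List.count_cons_of_ne hac, List.count_cons_of_ne hbc, List.count_cons_of_ne hba,
      List.count_cons_of_ne hca, List.count_cons_of_ne hcb, ua, ub, uc, va, vb, vc, wa, wb, wc,
      Rr_not ua, Rr_not ub, Rr_not uc, Rr_not va, Rr_not vb, Rr_not vc, Rr_not wa, Rr_not wb,
      Rr_not wc]
     generalize (List.map (fun _ => (-1 : ℤ)) u).prod = U at *
     generalize (List.map (fun _ => (-1 : ℤ)) v).prod = V at *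
     clear ua ub uc va vb vc wa wb wc
     grind)
  · intro k k' h0 h1 h2 h3
    have e : ∀ l : List ℕ, l.count x = 0 → l.count y = 0 → l.count c = 0 → Tt k' l = Tt k l := by
      intro l l1 l2 l3
      rw [List.count_eq_zero] at l1 l2 l3
      apply Tt_congr
      intro d hd
      apply h0 <;> rintro rfl <;> contradiction
    have eu := e u ua ub uc
    have ev := e v va vb vc
    have ew := e w wa wb wc
    rcases hc with ⟨rfl, rfl, rfl, rfl⟩ | ⟨rfl, rfl, rfl, rfl⟩ | ⟨rfl, rfl, rfl, rfl⟩ |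
      ⟨rfl, rfl, rfl, rfl⟩ | ⟨rfl, rfl, rfl, rfl⟩ | ⟨rfl, rfl, rfl, rfl⟩ | ⟨rfl, rfl, rfl, rfl⟩ |
      ⟨rfl, rfl, rfl, rfl⟩ <;>
    (simp only [Tt, Tt_append, h1, h2, h3, eu, ev, ew]
     ring)

theorem r3_cases (x y z t p q : ℕ) (hxy : x ≠ y) (hzt : z ≠ t) (hpq : p ≠ q)
    (h : ∀ d, List.count d [x, y, z, t, p, q] = 0 ∨ List.count d [x, y, z, t, p, q] = 2) :
    ∃ c, x ≠ c ∧ y ≠ c ∧ ((z = x ∧ t = c ∧ p = y ∧ q = c) ∨ (z = x ∧ t = c ∧ p = c ∧ q = y) ∨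
      (z = c ∧ t = x ∧ p = y ∧ q = c) ∨ (z = c ∧ t = x ∧ p = c ∧ q = y) ∨
      (z = y ∧ t = c ∧ p = x ∧ q = c) ∨ (z = y ∧ t = c ∧ p = c ∧ q = x) ∨
      (z = c ∧ t = y ∧ p = x ∧ q = c) ∨ (z = c ∧ t = y ∧ p = c ∧ q = x)) := by
  have h1 := h x
  have h2 := h y
  have h3 := h z
  have h4 := h t
  have h5 := h p
  have h6 := h q
  clear h
  simp only [List.count_cons, List.count_nil, beq_iff_eq] at *
  by_cases z = x
  · refine ⟨t, ?_⟩; grind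
  by_cases z = y
  · refine ⟨t, ?_⟩; grind
  · refine ⟨z, ?_⟩; grind

/-- labels -/
def lab (D : GDiagram) : List ℕ := D.map Prod.fst

theorem lab_count (D : GDiagram) (a : ℕ) :
    (lab D).count a = D.count (a, true) + D.count (a, false) := by
  induction D with
  | nil => rfl
  | cons e D ih =>
    obtain ⟨l, s⟩ := e
    simp only [lab, List.map_cons, List.count_cons] at *
    rw [ih]
    by_cases h : l = a <;> cases s <;> simp [h] <;> omega

theorem GG_lab {D : GDiagram} (h : IsGauss D) : GG (lab D) := by
  intro a
  rw [lab_count]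
  rcases h a with ⟨h1, h2⟩ | ⟨h1, h2⟩ <;> simp [h1, h2]

theorem lab_append (u v : GDiagram) : lab (u ++ v) = lab u ++ lab v := by simp [lab]

theorem lab_relabel (f : ℕ → ℕ) (D : GDiagram) : lab (relabel f D) = (lab D).map f := by
  simp [lab, relabel, Function.comp_def]

theorem Same_inv {D D' : GDiagram} (h : Same D D') :
    (GG (lab D) ↔ GG (lab D')) ∧ (GG (lab D) → |Ii (lab D)| = |Ii (lab D')|) := by
  obtain ⟨f, u, v, hf, rfl, rfl⟩ := h
  rw [lab_relabel, lab_append, lab_append, GG_map f hf, Ii_map f hf]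
  refine ⟨⟨GG_perm List.perm_append_comm, GG_perm List.perm_append_comm⟩, fun h => ?_⟩
  exact (Ii_rot _ _ h).symm

theorem rot_eq (u X Y : List ℕ) (hX : GG (u ++ X)) (hY : GG (u ++ Y))
    (h : GG (X ++ u) → |Ii (X ++ u)| = |Ii (Y ++ u)|) : |Ii (u ++ X)| = |Ii (u ++ Y)| := by
  rw [← Ii_rot u X hX, ← Ii_rot u Y hY]
  exact h (GG_perm List.perm_append_comm hX)

theorem fr1_inv {D D' : GDiagram} (h : fr1 D D') (g : GG (lab D)) (g' : GG (lab D')) :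
    |Ii (lab D)| = |Ii (lab D')| := by
  obtain ⟨a, s, u, v, rfl, rfl⟩ := h
  have e : lab (u ++ [(a, s), (a, !s)] ++ v) = lab u ++ (a :: a :: lab v) := by simp [lab]
  rw [e] at g ⊢
  rw [lab_append] at g' ⊢
  refine rot_eq _ _ _ g g' fun h => ?_
  exact congrArg _ (Ii_r1 a (lab v ++ lab u) h)

theorem fr2_inv {D D' : GDiagram} (h : fr2 D D') (g : GG (lab D)) (g' : GG (lab D')) :
    |Ii (lab D)| = |Ii (lab D')| := by
  obtain ⟨a, b, x, y, z, t, u, v, w, hab, h1, h2, rfl, rfl⟩ := h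
  have e : lab (u ++ [(x, true), (y, true)] ++ v ++ [(z, false), (t, false)] ++ w) =
      lab u ++ (x :: y :: (lab v ++ z :: t :: lab w)) := by simp [lab]
  have e' : lab (u ++ v ++ w) = lab u ++ (lab v ++ lab w) := by simp [lab]
  rw [e] at g ⊢
  rw [e'] at g' ⊢
  have h1' : (x = a ∧ y = b) ∨ (x = b ∧ y = a) := by
    rwa [Set.pair_eq_pair_iff] at h1
  have h2' : (z = a ∧ t = b) ∨ (z = b ∧ t = a) := by
    rwa [Set.pair_eq_pair_iff] at h2
  refine rot_eq _ _ _ g g' fun h => ?_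
  have := Ii_r2 x y z t (lab v) (lab w ++ lab u) (by grind) (by grind) (by simpa using h)
  simp only [List.cons_append, List.append_assoc] at this ⊢
  rw [this]

theorem fr3_inv {D D' : GDiagram} (h : fr3 D D') (g : GG (lab D)) (g' : GG (lab D')) :
    |Ii (lab D)| = |Ii (lab D')| := by
  obtain ⟨a, b, c, ⟨x, _⟩, ⟨y, _⟩, ⟨z, _⟩, ⟨t, _⟩, ⟨p, _⟩, ⟨q, _⟩, u, v, w, r, hab, hbc, hac,
    h1, h2, h3, hm, rfl, rfl⟩ := h
  simp only at h1 h2 h3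
  have hm' := congrArg (Multiset.map Prod.fst) hm
  simp only [Multiset.insert_eq_cons, Multiset.map_cons, Multiset.map_singleton] at hm'
  have hcnt : ∀ d, List.count d [x, y, z, t, p, q] = 0 ∨ List.count d [x, y, z, t, p, q] = 2 := by
    intro d
    have h5 := congrArg (Multiset.count d) hm'
    have h6 : List.count d [x, y, z, t, p, q] = List.count d [a, a, b, b, c, c] := by
      simp only [← Multiset.cons_zero, Multiset.count_cons, Multiset.count_zero] at h5
      simp only [List.count_cons, List.count_nil, beq_iff_eq]
      grind
    rw [h6]
    simp only [List.count_cons, List.count_nil, beq_iff_eq]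
    grind
  obtain ⟨k, hk1, hk2, hk⟩ := r3_cases x y z t p q h1 h2 h3 hcnt
  simp only [lab, List.map_append, List.map_cons, List.map_nil, List.append_assoc,
    List.cons_append, List.nil_append] at *
  refine rot_eq _ _ _ g g' fun h => ?_
  have := Ii_r3 x y k x y z t p q (v.map Prod.fst) (w.map Prod.fst)
    (r.map Prod.fst ++ u.map Prod.fst) h1 hk1 hk2 ⟨rfl, rfl⟩ hk (by simpa using h)
  simp only [List.cons_append, List.append_assoc] at this ⊢
  rw [this]

theorem step_inv {r : GDiagram → GDiagram → Prop}
    (hr : ∀ D D', r D D' → GG (lab D) → GG (lab D') → |Ii (lab D)| = |Ii (lab D')|)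
    {D D' : GDiagram} (h : stepOf r D D') (g : GG (lab D)) (g' : GG (lab D')) :
    |Ii (lab D)| = |Ii (lab D')| := by
  obtain ⟨E, E', h1, h2, h3⟩ := h
  have s1 := Same_inv h1
  have s3 := Same_inv h3
  have gE := s1.1.1 g
  have gE' := s3.1.2 g'
  rw [s1.2 g, hr _ _ h2 gE gE', s3.2 gE']

theorem Move_inv {D D' : GDiagram} (h : Move D D') : |Ii (lab D)| = |Ii (lab D')| := by
  obtain ⟨g, g', h⟩ := h
  have g := GG_lab g
  have g' := GG_lab g'
  rcases h with h | h | h | h | h | h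
  · exact step_inv (fun _ _ => fr1_inv) h g g'
  · exact step_inv (fun _ _ h a b => (fr1_inv h b a).symm) h g g'
  · exact step_inv (fun _ _ => fr2_inv) h g g'
  · exact step_inv (fun _ _ h a b => (fr2_inv h b a).symm) h g g'
  · exact step_inv (fun _ _ => fr3_inv) h g g'
  · exact (Same_inv h).2 g

theorem FlatEq_inv {D D' : GDiagram} (h : FlatEq D D') : |Ii (lab D)| = |Ii (lab D')| := by
  induction h with
  | rel _ _ h => exact Move_inv h
  | refl => rfl
  | symm _ _ _ ih => exact ih.symm
  | trans _ _ _ _ _ ih1 ih2 => exact ih1.trans ih2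

def exA (n : ℕ) : GDiagram := [(n, true), (n+1, true), (n, false), (n+2, true), (n+3, true),
  (n+1, false), (n+4, true), (n+2, false), (n+4, false), (n+3, false)]

def exB (n : ℕ) : GDiagram := [(n+1, true), (n, false), (n+2, true), (n+3, true),
  (n+1, false), (n+4, true), (n+2, false), (n+4, false), (n+3, false), (n, true)]

theorem exA_gauss (n : ℕ) : IsGauss (exA n) := by
  intro a
  simp only [exA, List.count_cons, List.count_nil, beq_iff_eq, Prod.mk.injEq]
  by_cases h : n ≤ a ∧ a ≤ n + 4
  · obtain ⟨h1, h2⟩ := h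
    obtain ⟨m, rfl⟩ := Nat.exists_eq_add_of_le h1
    have : m < 5 := by omega
    right
    interval_cases m <;> simp
  · left
    have : n ≠ a ∧ n + 1 ≠ a ∧ n + 2 ≠ a ∧ n + 3 ≠ a ∧ n + 4 ≠ a := by omega
    simp [this]

/-- The connected sum of flat virtual knots depends on the
choice of basepoints: there exist Gauss diagrams `D1`, `D2` and two
different choices of basepoints on them (a choice of basepoint on the cyclic
diagram of `Di` being a rotation `Ei` of `Di`) such that the two
resulting connected sum Gauss diagrams represent flat-inequivalent flat
virtual knots. -/
theorem connSum_depends_on_basepoints :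
    ∃ D1 D2 E1 E2 : GDiagram, IsGauss D1 ∧ IsGauss D2 ∧
      Rot D1 E1 ∧ Rot D2 E2 ∧
      LabelDisjoint D1 D2 ∧ LabelDisjoint E1 E2 ∧
      ¬ FlatEq (D1 ++ D2) (E1 ++ E2) := by
  refine ⟨exA 0, exA 5, exA 0, exB 5, exA_gauss 0, exA_gauss 5, ⟨[], exA 0, rfl, by simp⟩,
    ⟨[(5, true)], (exA 5).tail, rfl, rfl⟩, ?_, ?_, ?_⟩
  · intro a s s' h1 h2
    simp [exA] at h1 h2
    omega
  · intro a s s' h1 h2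
    simp [exA, exB] at h1 h2
    omega
  · intro h
    have := FlatEq_inv h
    revert this
    decide +kernel
end
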